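/- arXiv:1011.1536 — 10 statements merged into one kernel-verified Lean document; each statement's English description precedes it below -/
import Mathlib

section
/- Let r ≥ 1 and let g be a polynomial in ℤ[t_1, …, t_r]. For each i with 1 ≤ i ≤ r, let g_i ∈ ℤ[t_1, …, t_{r−1}] denote the polynomial obtained from g by substituting 0 for the i-th variable and relabelling the later variables, i.e. g_i(t_1,…,t_{r−1}) = g(t_1,…,t_{i−1},0,t_i,…,t_{r−1}). Then g is a ℤ-linear combination of quasi-symmetric monomials if and only if g_1 = g_2 = ⋯ = g_r. -/
open scoped Classical
open MvPolynomial

/-- The quasi-symmetric monomial `M_ω` in `r` variables associated to a composition `ω`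
(a finite, possibly empty, list of positive integers):
`M_ω(t_1,…,t_r) = ∑_{1 ≤ l_1 < ⋯ < l_k ≤ r} t_{l_1}^{j_1} ⋯ t_{l_k}^{j_k}`. -/
noncomputable def qsymMonomial (r : ℕ) (ω : List ℕ+) : MvPolynomial (Fin r) ℤ :=
  ∑ l ∈ Finset.univ.filter (fun l : Fin ω.length → Fin r => StrictMono l),
    ∏ i : Fin ω.length, X (l i) ^ ((ω.get i : ℕ))

/-- Substituting `0` for the `i`-th of `m+1` variables and relabelling the later variables:
`(substZero i g)(t_1,…,t_m) = g(t_1,…,t_{i-1},0,t_i,…,t_m)`. -/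
noncomputable def substZero {m : ℕ} (i : Fin (m + 1)) :
    MvPolynomial (Fin (m + 1)) ℤ →ₐ[ℤ] MvPolynomial (Fin m) ℤ :=
  aeval fun j : Fin (m + 1) =>
    if _h : (j : ℕ) < (i : ℕ) then X (⟨j, by have := i.isLt; omega⟩ : Fin m)
    else if _h' : (j : ℕ) = (i : ℕ) then 0
    else X (⟨(j : ℕ) - 1, by have := j.isLt; omega⟩ : Fin m)

lemma substZero_X_self {m : ℕ} (i : Fin (m + 1)) : substZero i (X i) = 0 := by
  simp [substZero]

lemma substZero_X_succAbove {m : ℕ} (i : Fin (m + 1)) (j : Fin m) :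
    substZero i (X (i.succAbove j)) = X j := by
  simp only [substZero, aeval_X]
  rcases lt_or_ge j.castSucc i with h | h
  · rw [Fin.succAbove_of_castSucc_lt _ _ h]
    have h' : (j : ℕ) < (i : ℕ) := h
    simp [h']
  · rw [Fin.succAbove_of_le_castSucc _ _ h]
    have h' : (i : ℕ) ≤ (j : ℕ) := h
    have h1 : ¬ (j : ℕ) + 1 < (i : ℕ) := by omega
    have h2 : ¬ (j : ℕ) + 1 = (i : ℕ) := by omega
    simp [h1, h2]

lemma substZero_monomial {m : ℕ} (i : Fin (m + 1)) (e : Fin (m + 1) →₀ ℕ) (c : ℤ) :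
    substZero i (monomial e c) =
      if e i = 0 then monomial (Finsupp.equivFunOnFinite.symm fun j => e (i.succAbove j)) c
      else 0 := by
  rw [monomial_eq, Finsupp.prod_fintype _ _ (by simp), Fin.prod_univ_succAbove _ i]
  simp only [map_mul, map_prod, map_pow, substZero_X_self, substZero_X_succAbove]
  split_ifs with h
  · rw [h, monomial_eq, Finsupp.prod_fintype _ _ (by simp)]
    simp
  · simp [h]

lemma coeff_of_substZero {m : ℕ} (i : Fin (m + 1)) (e : Fin (m + 1) →₀ ℕ) (he : e i = 0)
    (g : MvPolynomial (Fin (m + 1)) ℤ) :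
    coeff (Finsupp.equivFunOnFinite.symm fun j => e (i.succAbove j)) (substZero i g)
      = coeff e g := by
  induction g using MvPolynomial.induction_on' with
  | monomial d c =>
    rw [substZero_monomial]
    split_ifs with h
    · rw [coeff_monomial, coeff_monomial]
      congr 1
      apply propext
      constructor
      · intro hh
        ext k
        rcases Fin.eq_self_or_eq_succAbove i k with rfl | ⟨j, rfl⟩
        · rw [h, he]
        · simpa using DFunLike.congr_fun hh j
      · rintro rfl; rfl
    · rw [coeff_monomial, if_neg]
      · simp
      · rintro rfl; exact h he
  | add p q hp hq => simp [hp, hq]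

lemma substZero_qsym {m : ℕ} (i : Fin (m + 1)) (ω : List ℕ+) :
    substZero i (qsymMonomial (m + 1) ω) = qsymMonomial m ω := by
  unfold qsymMonomial
  rw [map_sum]
  symm
  apply Finset.sum_of_injOn (fun l k => i.succAbove (l k))
  · intro l _ l' _ h
    funext k
    exact Fin.succAbove_right_injective (congrFun h k)
  · intro l hl
    simp only [Finset.coe_filter, Finset.mem_univ, true_and, Set.mem_ofPred_eq] at hl ⊢
    exact (Fin.strictMono_succAbove i).comp hl
  · intro l hl hn
    simp only [Finset.mem_filter, Finset.mem_univ, true_and] at hl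
    by_cases h : ∃ k, l k = i
    · obtain ⟨k, hk⟩ := h
      rw [map_prod]
      apply Finset.prod_eq_zero (Finset.mem_univ k)
      rw [hk, map_pow, substZero_X_self, zero_pow (PNat.ne_zero _)]
    · exfalso
      push Not at h
      choose l' hl' using fun k => Fin.exists_succAbove_eq (h k)
      apply hn
      refine ⟨l', ?_, funext hl'⟩
      simp only [Finset.coe_filter, Finset.mem_univ, true_and, Set.mem_ofPred_eq]
      intro a b hab
      have := hl hab
      rw [← hl' a, ← hl' b] at this
      exact (Fin.strictMono_succAbove i).lt_iff_lt.1 this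
  · intro l _
    simp only [map_prod, map_pow, substZero_X_succAbove]

lemma substZero_comm {m : ℕ} (j : Fin (m + 1)) (g : MvPolynomial (Fin (m + 2)) ℤ) :
    substZero j (substZero 0 g) = substZero 0 (substZero j.succ g) := by
  have : (substZero j).comp (substZero 0) = (substZero 0).comp (substZero j.succ) := by
    apply MvPolynomial.algHom_ext
    intro k
    simp only [AlgHom.comp_apply]
    induction k using Fin.cases with
    | zero =>
      rw [substZero_X_self, map_zero]
      have h := substZero_X_succAbove j.succ 0
      rw [Fin.succ_succAbove_zero] at h
      rw [h, substZero_X_self]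
    | succ k =>
      have h := substZero_X_succAbove 0 k
      rw [Fin.zero_succAbove] at h
      rw [h]
      rcases Fin.eq_self_or_eq_succAbove j k with rfl | ⟨l, rfl⟩
      · rw [substZero_X_self, substZero_X_self, map_zero]
      · rw [← Fin.succ_succAbove_succ, substZero_X_succAbove, substZero_X_succAbove]
        have h := substZero_X_succAbove 0 l
        rw [Fin.zero_succAbove] at h
        rw [h]
  exact DFunLike.congr_fun this g

lemma qsym_full (ω : List ℕ+) :
    qsymMonomial ω.length ω = ∏ i : Fin ω.length, X i ^ ((ω.get i : ℕ)) := by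
  unfold qsymMonomial
  rw [Finset.sum_eq_single id]
  · rfl
  · intro l hl hne
    simp only [Finset.mem_filter, Finset.mem_univ, true_and] at hl
    exact absurd (hl.eq_id) hne
  · intro h
    simp [strictMono_id] at h

lemma qsym_full' (r : ℕ) (ω : List ℕ+) (h : ω.length = r) :
    qsymMonomial r ω = ∏ i : Fin r, X i ^ ((ω.get (i.cast h.symm) : ℕ)) := by
  subst h
  exact qsym_full ω

lemma monomial_mem {r : ℕ} (e : Fin r →₀ ℕ) (he : ∀ i, e i ≠ 0) (c : ℤ) :
    monomial e c ∈ Submodule.span ℤ (Set.range (qsymMonomial r)) := by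
  have : monomial e c = c • qsymMonomial r
      (List.ofFn fun i => (e i).toPNat (Nat.pos_of_ne_zero (he i))) := by
    rw [qsym_full' r _ List.length_ofFn, monomial_eq, Finsupp.prod_fintype _ _ (by simp), smul_eq_C_mul]
    congr 1
    apply Finset.prod_congr rfl
    intro i _
    simp only [List.get_ofFn]
    rfl
  rw [this]
  exact Submodule.smul_mem _ _ (Submodule.subset_span ⟨_, rfl⟩)

lemma lift_span {m : ℕ} (h : MvPolynomial (Fin m) ℤ)
    (hh : h ∈ Submodule.span ℤ (Set.range (qsymMonomial m))) :
    ∃ H ∈ Submodule.span ℤ (Set.range (qsymMonomial (m + 1))), ∀ i, substZero i H = h := by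
  induction hh using Submodule.span_induction with
  | mem x hx =>
    obtain ⟨ω, rfl⟩ := hx
    exact ⟨_, Submodule.subset_span ⟨ω, rfl⟩, fun i => substZero_qsym i ω⟩
  | zero => exact ⟨0, Submodule.zero_mem _, fun i => map_zero _⟩
  | add x y _ _ hx hy =>
    obtain ⟨a, ha, ha'⟩ := hx
    obtain ⟨b, hb, hb'⟩ := hy
    exact ⟨a + b, Submodule.add_mem _ ha hb, fun i => by rw [map_add, ha', hb']⟩
  | smul c x _ hx =>
    obtain ⟨a, ha, ha'⟩ := hx
    exact ⟨c • a, Submodule.smul_mem _ _ ha, fun i => by rw [map_smul, ha']⟩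

lemma step {m : ℕ} (g : MvPolynomial (Fin (m + 1)) ℤ)
    (hg : ∀ i i' : Fin (m + 1), substZero i g = substZero i' g)
    (h0 : substZero 0 g ∈ Submodule.span ℤ (Set.range (qsymMonomial m))) :
    g ∈ Submodule.span ℤ (Set.range (qsymMonomial (m + 1))) := by
  obtain ⟨H, hH, hH'⟩ := lift_span _ h0
  rw [← Submodule.sub_mem_iff_left _ hH, (g - H).as_sum]
  apply Submodule.sum_mem
  intro e he
  apply monomial_mem
  intro i hi
  rw [mem_support_iff] at he
  apply he
  rw [← coeff_of_substZero i e hi, map_sub, hH' i, hg i 0, sub_self, coeff_zero]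

theorem statement0 (m : ℕ) (g : MvPolynomial (Fin (m + 1)) ℤ) :
    g ∈ Submodule.span ℤ (Set.range (qsymMonomial (m + 1))) ↔
      ∀ i i' : Fin (m + 1), substZero i g = substZero i' g := by
  constructor
  · intro hg i i'
    induction hg using Submodule.span_induction with
    | mem x hx =>
      obtain ⟨ω, rfl⟩ := hx
      rw [substZero_qsym, substZero_qsym]
    | zero => simp
    | add x y _ _ hx hy => rw [map_add, map_add, hx, hy]
    | smul c x _ hx => rw [map_smul, map_smul, hx]
  · intro hg
    induction m with
    | zero =>
      apply step g hg
      rw [(substZero 0 g).as_sum]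
      exact Submodule.sum_mem _ fun e _ => monomial_mem e (fun i => i.elim0) _
    | succ m ih =>
      apply step g hg
      apply ih
      intro i i'
      rw [substZero_comm, substZero_comm, hg i.succ i'.succ]
end

section
/- Let F be the free associative ℚ-algebra on generators Z_1, Z_2, Z_3, … indexed by the positive integers, and set Z_0 = 1. Let J be the two-sided ideal of F generated by the elements ∑_{i=0}^{n} (−1)^i Z_i Z_{n−i} for all n ≥ 2. Then the ℚ-algebra homomorphism from the free associative ℚ-algebra on generators W_1, W_3, W_5, … indexed by the odd positive integers to the quotient F/J that sends each W_{2k−1} to the class of Z_{2k−1} is an isomorphism of ℚ-algebras. -/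
/-- The free associative `ℚ`-algebra `F` on generators `Z₁, Z₂, Z₃, …` indexed by the
positive integers. -/
abbrev FreeZ : Type := FreeAlgebra ℚ {n : ℕ // 0 < n}

/-- `Z n` is the `n`-th generator for `n ≥ 1`, with the convention `Z 0 = 1`. -/
noncomputable def Z (n : ℕ) : FreeZ :=
  if h : 0 < n then FreeAlgebra.ι ℚ (⟨n, h⟩ : {n : ℕ // 0 < n}) else 1

/-- The relations generating the two-sided ideal `J`:
`∑_{i=0}^{n} (−1)^i Z_i Z_{n−i} = 0` for all `n ≥ 2`.  The quotient `F/J` is realized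
as `RingQuot zRel`. -/
def zRel : FreeZ → FreeZ → Prop := fun x y =>
  ∃ n : ℕ, 2 ≤ n ∧
    x = ∑ i ∈ Finset.range (n + 1), ((-1 : ℚ) ^ i) • (Z i * Z (n - i)) ∧ y = 0

/-- The elements of the free algebra on the odd generators that `Z n` maps to. -/
noncomputable def aSeq : ℕ → FreeAlgebra ℚ {n : ℕ // Odd n}
  | 0 => 1
  | n + 1 =>
    if h : Odd (n + 1) then FreeAlgebra.ι ℚ (⟨n + 1, h⟩ : {n : ℕ // Odd n})
    else (-(1 / 2) : ℚ) • ∑ i : Fin n, ((-1 : ℚ) ^ (i.1 + 1)) • (aSeq (i.1 + 1) * aSeq (n - i.1))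
  termination_by n => n
  decreasing_by all_goals omega

/-- The alternating sums. -/
noncomputable def altS {R : Type} [Ring R] [Algebra ℚ R] (a : ℕ → R) (n : ℕ) : R :=
  ∑ i ∈ Finset.range (n + 1), ((-1 : ℚ) ^ i) • (a i * a (n - i))

lemma altS_even {R : Type} [Ring R] [Algebra ℚ R] (a : ℕ → R) (h0 : a 0 = 1) (n : ℕ)
    (hn : ¬ Odd (n + 1)) :
    altS a (n + 1) = (2 : ℚ) • a (n + 1) +
      ∑ i ∈ Finset.range n, ((-1 : ℚ) ^ (i + 1)) • (a (i + 1) * a (n - i)) := by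
  unfold altS
  rw [Finset.sum_range_succ, Finset.sum_range_succ']
  have he : Even (n + 1) := Nat.not_odd_iff_even.mp hn
  simp only [he.neg_one_pow, h0, Nat.sub_self, Nat.sub_zero, pow_zero, one_smul, one_mul, mul_one,
    Nat.add_sub_add_right]
  rw [two_smul]
  abel

lemma altS_odd {R : Type} [Ring R] [Algebra ℚ R] (a : ℕ → R) (h0 : a 0 = 1)
    (he : ∀ n, 0 < n → Even n → altS a n = 0) : ∀ n, 0 < n → altS a n = 0 := by
  intro n
  induction n using Nat.strong_induction_on with
  | _ n ih =>
  intro hn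
  rcases Nat.even_or_odd n with hev | hodd
  · exact he n hn hev
  let A : PowerSeries R := PowerSeries.mk a
  let B : PowerSeries R := PowerSeries.mk fun i => ((-1 : ℚ) ^ i) • a i
  have hBA : ∀ k, PowerSeries.coeff k (B * A) = altS a k := by
    intro k
    rw [PowerSeries.coeff_mul, Finset.Nat.sum_antidiagonal_eq_sum_range_succ_mk]
    simp [A, B, altS]
  have hAB : ∀ k, PowerSeries.coeff k (A * B) = ((-1 : ℚ) ^ k) • altS a k := by
    intro k
    rw [PowerSeries.coeff_mul, Finset.Nat.sum_antidiagonal_eq_sum_range_succ_mk]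
    simp only [A, B, altS, PowerSeries.coeff_mk, Finset.smul_sum, smul_smul]
    refine Finset.sum_congr rfl fun i hi => ?_
    have hik : i ≤ k := by simpa [Nat.lt_succ_iff] using hi
    rw [mul_smul_comm]
    congr 1
    obtain ⟨j, rfl⟩ := Nat.exists_eq_add_of_le hik
    rw [Nat.add_sub_cancel_left, pow_add, mul_right_comm, ← pow_add,
      (Even.add_self i).neg_one_pow, one_mul]
  have hS0 : altS a 0 = 1 := by simp [altS, h0]
  have key : PowerSeries.coeff n (A * (B * A)) = PowerSeries.coeff n ((A * B) * A) := by
    rw [mul_assoc]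
  obtain ⟨m, rfl⟩ : ∃ m, n = m + 1 := ⟨n - 1, by omega⟩
  rw [PowerSeries.coeff_mul, PowerSeries.coeff_mul,
    Finset.Nat.sum_antidiagonal_eq_sum_range_succ_mk,
    Finset.Nat.sum_antidiagonal_eq_sum_range_succ_mk] at key
  simp only [hBA, hAB] at key
  rw [Finset.sum_range_succ, Finset.sum_range_succ', Finset.sum_range_succ,
    Finset.sum_range_succ'] at key
  have z1 : ∑ k ∈ Finset.range m,
      PowerSeries.coeff (k + 1) A * altS a (m + 1 - (k + 1)) = 0 := by
    refine Finset.sum_eq_zero fun k hk => ?_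
    have : k < m := by simpa using hk
    rw [ih _ (by omega) (by omega), mul_zero]
  have z2 : ∑ k ∈ Finset.range m,
      ((-1 : ℚ) ^ (k + 1) • altS a (k + 1)) * PowerSeries.coeff (m + 1 - (k + 1)) A = 0 := by
    refine Finset.sum_eq_zero fun k hk => ?_
    have : k < m := by simpa using hk
    rw [ih _ (by omega) (by omega), smul_zero, zero_mul]
  rw [z1, z2] at key
  simp only [A, PowerSeries.coeff_mk, h0, hS0, hodd.neg_one_pow, Nat.sub_self, Nat.sub_zero,
    zero_add, one_mul, mul_one, pow_zero, one_smul, neg_smul] at key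
  have h2 : (2 : ℚ) • altS a (m + 1) = 0 := by
    rw [two_smul]
    have h3 : altS a (m + 1) = - altS a (m + 1) := by
      rw [add_comm] at key
      exact add_left_cancel key
    nth_rewrite 1 [h3]
    simp
  exact (smul_eq_zero.mp h2).resolve_left (by norm_num)

lemma aSeq_zero : aSeq 0 = 1 := by
  rw [aSeq]

lemma aSeq_odd (n : ℕ) (h : Odd n) : aSeq n = FreeAlgebra.ι ℚ (⟨n, h⟩ : {n : ℕ // Odd n}) := by
  cases n with
  | zero => exact absurd h (by decide)
  | succ n => rw [aSeq, dif_pos h]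

lemma aSeq_rel : ∀ n, 0 < n → altS aSeq n = 0 := by
  apply altS_odd aSeq aSeq_zero
  intro n hn he
  obtain ⟨m, rfl⟩ : ∃ m, n = m + 1 := ⟨n - 1, by omega⟩
  have ho : ¬ Odd (m + 1) := Nat.not_odd_iff_even.mpr he
  rw [altS_even aSeq aSeq_zero m ho, aSeq, dif_neg ho, smul_smul,
    Fin.sum_univ_eq_sum_range
      (fun i => ((-1 : ℚ) ^ (i + 1)) • (aSeq (i + 1) * aSeq (m - i))) m]
  norm_num

lemma Z_zero : Z 0 = 1 := by simp [Z]

/-- The map out of the free algebra on all the generators. -/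
noncomputable def gFree : FreeZ →ₐ[ℚ] FreeAlgebra ℚ {n : ℕ // Odd n} :=
  FreeAlgebra.lift ℚ fun n => aSeq n.1

lemma gFree_Z (n : ℕ) : gFree (Z n) = aSeq n := by
  unfold Z
  split_ifs with h
  · simp [gFree]
  · obtain rfl : n = 0 := by omega
    simp [aSeq_zero]

lemma gFree_rel : ∀ ⦃x y : FreeZ⦄, zRel x y → gFree x = gFree y := by
  rintro x y ⟨n, hn, rfl, rfl⟩
  have := aSeq_rel n (by omega)
  simpa [map_sum, gFree_Z, altS] using this

/-- The `ℚ`-algebra homomorphism from the free associative `ℚ`-algebra on generators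
`W₁, W₃, W₅, …` indexed by the odd positive integers to `F/J`, sending each `W_{2k−1}`
to the class of `Z_{2k−1}`, is an isomorphism of `ℚ`-algebras. -/
theorem statement3 :
    Function.Bijective
      ⇑((FreeAlgebra.lift ℚ
          fun w : {n : ℕ // Odd n} => RingQuot.mkAlgHom ℚ zRel (Z w.1)) :
        FreeAlgebra ℚ {n : ℕ // Odd n} →ₐ[ℚ] RingQuot zRel) := by
  set f := ((FreeAlgebra.lift ℚ
          fun w : {n : ℕ // Odd n} => RingQuot.mkAlgHom ℚ zRel (Z w.1)) :
        FreeAlgebra ℚ {n : ℕ // Odd n} →ₐ[ℚ] RingQuot zRel) with hf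
  constructor
  · let g : RingQuot zRel →ₐ[ℚ] FreeAlgebra ℚ {n : ℕ // Odd n} :=
      RingQuot.liftAlgHom ℚ ⟨gFree, gFree_rel⟩
    have hgf : g.comp f = AlgHom.id ℚ _ := by
      ext w
      simp [hf, g, gFree_Z, aSeq_odd w.1 w.2]
    exact Function.LeftInverse.injective (g := g) fun x => DFunLike.congr_fun hgf x
  · have hZ : ∀ n, RingQuot.mkAlgHom ℚ zRel (Z n) ∈ f.range := by
      intro n
      induction n using Nat.strong_induction_on with
      | _ n ih =>
      rcases Nat.eq_zero_or_pos n with rfl | hn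
      · rw [Z_zero, map_one]; exact one_mem _
      by_cases ho : Odd n
      · exact ⟨FreeAlgebra.ι ℚ ⟨n, ho⟩, by simp [hf]⟩
      obtain ⟨m, rfl⟩ : ∃ m, n = m + 1 := ⟨n - 1, by omega⟩
      have hm : 2 ≤ m + 1 := by
        rcases m with _ | m
        · exact absurd (by decide) ho
        · omega
      have hr : RingQuot.mkAlgHom ℚ zRel (altS Z (m + 1)) = 0 := by
        have := RingQuot.mkAlgHom_rel ℚ (s := zRel) (x := altS Z (m + 1)) (y := 0)
          ⟨m + 1, hm, rfl, rfl⟩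
        simpa using this
      rw [altS_even Z Z_zero m ho, map_add, map_smul] at hr
      have hs : (2 : ℚ) • RingQuot.mkAlgHom ℚ zRel (Z (m + 1)) ∈ f.range := by
        rw [eq_neg_of_add_eq_zero_left hr, map_sum]
        refine neg_mem (sum_mem fun i hi => ?_)
        have : i < m := by simpa using hi
        rw [map_smul, map_mul]
        exact Subalgebra.smul_mem _ (mul_mem (ih _ (by omega)) (ih _ (by omega))) _
      have := Subalgebra.smul_mem _ hs (1 / 2 : ℚ)
      rw [smul_smul] at this
      norm_num at this
      simpa using this
    intro y
    obtain ⟨x, rfl⟩ := RingQuot.mkAlgHom_surjective ℚ zRel y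
    change RingQuot.mkAlgHom ℚ zRel x ∈ f.range
    induction x using FreeAlgebra.induction with
    | grade0 r => rw [AlgHom.commutes]; exact Subalgebra.algebraMap_mem _ r
    | grade1 n =>
      have := hZ n.1
      rwa [Z, dif_pos n.2] at this
    | mul a b ha hb => rw [map_mul]; exact mul_mem ha hb
    | add a b ha hb => rw [map_add]; exact add_mem ha hb
end

section
/- For every k ≥ 1, d_{2k} = ∑_{i=1}^{k} (−1)^{i−1} · (binom(2i−2, i−1) / (i · 2^{2i−1})) · ( ∑ d_{2j_1−1} d_{2j_2−1} ⋯ d_{2j_{2i}−1} ), where the inner sum ranges over all 2i-tuples (j_1, …, j_{2i}) of positive integers with j_1 + j_2 + ⋯ + j_{2i} = i + k. In particular every even-indexed element d_{2k} is a ℚ-polynomial expression in the odd-indexed elements d_1, d_3, d_5, … -/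
open Finset in
lemma aux_split {M : Type*} [AddCommMonoid M] (f : ℕ → M) (m : ℕ) :
    ∑ i ∈ range (2 * m + 1), f i
      = ∑ i ∈ range (m + 1), f (2 * i) + ∑ i ∈ range m, f (2 * i + 1) := by
  induction m with
  | zero => simp
  | succ m ih =>
    rw [show 2 * (m + 1) + 1 = 2 * m + 1 + 1 + 1 by ring, sum_range_succ, sum_range_succ, ih,
      sum_range_succ (fun i => f (2 * i)) (m + 1), sum_range_succ (fun i => f (2 * i + 1)) m,
      show 2 * m + 1 + 1 = 2 * (m + 1) by ring]
    abel

/-- coefficients of the square root of `1 + X` -/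
def auxC : ℕ → ℚ
  | 0 => 1
  | (i + 1) => (1 / 2) * ((-1 / 4) ^ i * catalan i)

lemma auxF_eq : (PowerSeries.mk fun i => ((-1 / 4 : ℚ) ^ i * catalan i))
    = 1 + PowerSeries.C (-1 / 4 : ℚ) * (PowerSeries.X *
      ((PowerSeries.mk fun i => ((-1 / 4 : ℚ) ^ i * catalan i)) *
        (PowerSeries.mk fun i => ((-1 / 4 : ℚ) ^ i * catalan i)))) := by
  ext n
  cases n with
  | zero => simp
  | succ n =>
    rw [map_add, PowerSeries.coeff_C_mul, PowerSeries.coeff_succ_X_mul, PowerSeries.coeff_mul]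
    simp only [PowerSeries.coeff_mk, PowerSeries.coeff_one, Nat.succ_ne_zero, if_false, zero_add]
    rw [catalan_succ', pow_succ, Nat.cast_sum, Finset.mul_sum, Finset.mul_sum]
    refine Finset.sum_congr rfl fun x hx => ?_
    rw [Finset.HasAntidiagonal.mem_antidiagonal] at hx
    rw [← hx, pow_add]
    push_cast
    ring

lemma auxC_sq : (PowerSeries.mk auxC) * (PowerSeries.mk auxC) = 1 + PowerSeries.X := by
  have h : PowerSeries.mk auxC = 1 + PowerSeries.C (1 / 2 : ℚ) * (PowerSeries.X *
      (PowerSeries.mk fun i => ((-1 / 4 : ℚ) ^ i * catalan i))) := by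
    ext n
    cases n with
    | zero => simp [auxC]
    | succ n =>
      rw [map_add, PowerSeries.coeff_C_mul, PowerSeries.coeff_succ_X_mul]
      simp [auxC, PowerSeries.coeff_one]
  have hF := auxF_eq
  rw [h]
  generalize (PowerSeries.mk fun i => ((-1 / 4 : ℚ) ^ i * (catalan i : ℚ))) = F at *
  have h1 : (PowerSeries.C (-1 / 4 : ℚ)) = - (PowerSeries.C (1 / 2 : ℚ) * PowerSeries.C (1 / 2 : ℚ)) := by
    rw [← map_mul, ← map_neg]; norm_num
  have h2 : PowerSeries.C (1 / 2 : ℚ) + PowerSeries.C (1 / 2 : ℚ) = 1 := by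
    rw [← map_add, ← map_one (PowerSeries.C (R := ℚ))]; norm_num
  rw [h1] at hF
  generalize PowerSeries.C (1 / 2 : ℚ) = c at *
  linear_combination (PowerSeries.X * F) * h2 + PowerSeries.X * hF

lemma auxC_formula (i : ℕ) (hi : 1 ≤ i) :
    auxC i = (-1 : ℚ) ^ (i - 1) * (Nat.choose (2 * i - 2) (i - 1) : ℚ) /
              ((i : ℚ) * 2 ^ (2 * i - 1)) := by
  obtain ⟨i, rfl⟩ := Nat.exists_eq_add_of_le' hi
  have h := succ_mul_catalan_eq_centralBinom i
  rw [Nat.centralBinom] at h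
  rw [show 2 * (i + 1) - 2 = 2 * i by omega, show i + 1 - 1 = i by omega,
    show 2 * (i + 1) - 1 = 2 * i + 1 by omega, ← h]
  simp only [auxC]
  have : ((i : ℚ) + 1) ≠ 0 := by positivity
  rw [div_pow, pow_succ, pow_mul]
  push_cast
  norm_num
  field_simp

lemma aux_coeff_pow {A : Type*} [Ring A] (f : ℕ → A) (n m : ℕ) :
    PowerSeries.coeff m ((PowerSeries.mk f) ^ n) =
      ∑ j ∈ Finset.Nat.antidiagonalTuple n m, (List.ofFn fun a : Fin n => f (j a)).prod := by
  induction n generalizing m with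
  | zero =>
    cases m <;> simp [PowerSeries.coeff_one]
  | succ n ih =>
    rw [pow_succ', PowerSeries.coeff_mul]
    simp only [ih, Finset.mul_sum, PowerSeries.coeff_mk]
    rw [Finset.sum_sigma']
    refine Finset.sum_bij' (fun x _ => Fin.cons x.1.1 x.2)
      (fun j _ => ⟨(j 0, ∑ a, Fin.tail j a), Fin.tail j⟩) ?_ ?_ ?_ ?_ ?_
    · rintro ⟨⟨a, b⟩, j⟩ hx
      simp only [Finset.mem_sigma, Finset.HasAntidiagonal.mem_antidiagonal,
        Finset.Nat.mem_antidiagonalTuple] at hx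
      simp [Finset.Nat.mem_antidiagonalTuple, Fin.sum_univ_succ, hx]
    · intro j hj
      rw [Finset.Nat.mem_antidiagonalTuple, Fin.sum_univ_succ] at hj
      simp only [Finset.mem_sigma, Finset.HasAntidiagonal.mem_antidiagonal,
        Finset.Nat.mem_antidiagonalTuple]
      exact ⟨hj, trivial⟩
    · rintro ⟨⟨a, b⟩, j⟩ hx
      simp only [Finset.mem_sigma, Finset.HasAntidiagonal.mem_antidiagonal,
        Finset.Nat.mem_antidiagonalTuple] at hx
      simp [hx.2]
    · intro j hj
      simp
    · rintro ⟨⟨a, b⟩, j⟩ hx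
      simp [List.ofFn_succ]

lemma aux_shift {A : Type*} [Ring A] (d : ℕ → A) (i k : ℕ) (hik : i ≤ k) :
    ∑ j ∈ (Finset.Nat.antidiagonalTuple (2 * i) (i + k)).filter fun j => ∀ a, 0 < j a,
              (List.ofFn fun a : Fin (2 * i) => d (2 * j a - 1)).prod =
    ∑ j ∈ Finset.Nat.antidiagonalTuple (2 * i) (k - i),
              (List.ofFn fun a : Fin (2 * i) => d (2 * j a + 1)).prod := by
  symm
  refine Finset.sum_bij' (fun j _ a => j a + 1) (fun j _ a => j a - 1) ?_ ?_ ?_ ?_ ?_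
  · intro j hj
    rw [Finset.Nat.mem_antidiagonalTuple] at hj
    simp only [Finset.mem_filter, Finset.Nat.mem_antidiagonalTuple, Finset.sum_add_distrib, hj]
    simp
    omega
  · intro j hj
    simp only [Finset.mem_filter, Finset.Nat.mem_antidiagonalTuple] at hj ⊢
    have : ∑ a, j a = ∑ a, ((j a - 1) + 1) :=
      Finset.sum_congr rfl fun a _ => by have := hj.2 a; omega
    rw [hj.1, Finset.sum_add_distrib] at this
    simp at this
    omega
  · intro j hj; simp
  · intro j hj
    simp only [Finset.mem_filter] at hj
    funext a
    have := hj.2 a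
    show j a - 1 + 1 = j a
    omega
  · intro j hj
    rfl

lemma aux_half {A : Type*} [Ring A] [Algebra ℚ A] (a b : A) (h : a + a = b + b) : a = b := by
  have h1 := congrArg (fun x => (1 / 2 : ℚ) • x) h
  simp only [smul_add, ← add_smul] at h1
  norm_num at h1
  exact h1

lemma aux_sqrt_unique {A : Type*} [Ring A] [Algebra ℚ A] (E S : PowerSeries A) (N : ℕ)
    (hE : PowerSeries.coeff 0 E = 1) (hS : PowerSeries.coeff 0 S = 1)
    (h : ∀ n ≤ N, PowerSeries.coeff n (E * E) = PowerSeries.coeff n (S * S)) :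
    ∀ n ≤ N, PowerSeries.coeff n E = PowerSeries.coeff n S := by
  intro n
  induction n using Nat.strong_induction_on with
  | _ n ih =>
    intro hn
    cases n with
    | zero => rw [hE, hS]
    | succ n =>
      have h1 := h _ hn
      rw [PowerSeries.coeff_mul, PowerSeries.coeff_mul, Finset.Nat.sum_antidiagonal_succ,
        Finset.Nat.sum_antidiagonal_succ] at h1
      simp only [hE, hS, one_mul] at h1
      cases n with
      | zero =>
        simp [hE, hS] at h1
        exact aux_half _ _ h1
      | succ n =>
      rw [Finset.Nat.sum_antidiagonal_succ', Finset.Nat.sum_antidiagonal_succ'] at h1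
      simp only [hE, hS, mul_one] at h1
      have h2 : ∑ p ∈ Finset.HasAntidiagonal.antidiagonal n,
            PowerSeries.coeff (p.1 + 1) E * PowerSeries.coeff (p.2 + 1) E =
          ∑ p ∈ Finset.HasAntidiagonal.antidiagonal n,
            PowerSeries.coeff (p.1 + 1) S * PowerSeries.coeff (p.2 + 1) S := by
        refine Finset.sum_congr rfl fun x hx => ?_
        rw [Finset.HasAntidiagonal.mem_antidiagonal] at hx
        rw [ih (x.1 + 1) (by omega) (by omega), ih (x.2 + 1) (by omega) (by omega)]
      rw [h2] at h1
      apply aux_half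
      generalize PowerSeries.coeff (n + 1 + 1) E = u at *
      generalize PowerSeries.coeff (n + 1 + 1) S = v at *
      rw [← sub_eq_zero] at h1 ⊢
      rw [← h1]
      abel


/-- Let `A` be an associative unital `ℚ`-algebra and `d : ℕ → A` a sequence with
`d 0 = 1` satisfying `∑_{i=0}^{n} (−1)^i d_i d_{n−i} = 0` for every `n ≥ 1`
(i.e. `Φ(−t)Φ(t) = 1`).  Then for every `k ≥ 1`,
`d_{2k} = ∑_{i=1}^{k} (−1)^{i−1} (C(2i−2, i−1) / (i 2^{2i−1})) ∑ d_{2j₁−1} ⋯ d_{2j_{2i}−1}`,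
where the inner sum ranges over all `2i`-tuples `(j₁,…,j_{2i})` of positive integers with
`j₁ + ⋯ + j_{2i} = i + k`. -/
theorem statement4 (A : Type*) [Ring A] [Algebra ℚ A] (d : ℕ → A) (hd0 : d 0 = 1)
    (hrel : ∀ n : ℕ, 1 ≤ n →
      ∑ i ∈ Finset.range (n + 1), ((-1 : ℚ) ^ i) • (d i * d (n - i)) = 0) :
    ∀ k : ℕ, 1 ≤ k →
      d (2 * k) =
        ∑ i ∈ Finset.Icc 1 k,
          ((-1 : ℚ) ^ (i - 1) * (Nat.choose (2 * i - 2) (i - 1) : ℚ) /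
              ((i : ℚ) * 2 ^ (2 * i - 1))) •
            ∑ j ∈ (Finset.Nat.antidiagonalTuple (2 * i) (i + k)).filter
                fun j => ∀ a, 0 < j a,
              (List.ofFn fun a : Fin (2 * i) => d (2 * j a - 1)).prod := by
  intro k hk
  set E : PowerSeries A := PowerSeries.mk fun n => d (2 * n) with hE
  set P : PowerSeries A := PowerSeries.mk fun n => d (2 * n + 1) with hP
  set Q : PowerSeries A := PowerSeries.X * (P * P) with hQ
  have hQpow : ∀ i, Q ^ i = PowerSeries.X ^ i * P ^ (2 * i) := by
    intro i
    rw [hQ, (PowerSeries.commute_X _).symm.mul_pow, ← pow_two, ← pow_mul]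
  have hEE : E * E = 1 + Q := by
    ext m
    cases m with
    | zero => simp [hE, hQ, hd0, PowerSeries.coeff_mul]
    | succ m =>
      have h := hrel (2 * (m + 1)) (by omega)
      rw [aux_split] at h
      rw [map_add, hQ, PowerSeries.coeff_succ_X_mul, PowerSeries.coeff_mul, PowerSeries.coeff_mul,
        Finset.Nat.sum_antidiagonal_eq_sum_range_succ_mk,
        Finset.Nat.sum_antidiagonal_eq_sum_range_succ_mk]
      simp only [hE, hP, PowerSeries.coeff_mk, PowerSeries.coeff_one, Nat.succ_ne_zero, if_false,
        zero_add]
      rw [← sub_eq_zero, ← h, sub_eq_add_neg, ← Finset.sum_neg_distrib]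
      congr 1
      · refine Finset.sum_congr rfl fun i hi => ?_
        rw [pow_mul, Nat.mul_sub]; simp
      · refine Finset.sum_congr rfl fun i hi => ?_
        have := Finset.mem_range.1 hi
        rw [pow_succ, pow_mul, show 2 * (m + 1) - (2 * i + 1) = 2 * (m - i) + 1 by omega]; simp
  set p : Polynomial ℚ := PowerSeries.trunc (k + 1) (PowerSeries.mk auxC) with hp
  obtain ⟨r, hr⟩ : Polynomial.X ^ (k + 1) ∣ p * p - (1 + Polynomial.X) := by
    rw [Polynomial.X_pow_dvd_iff]
    intro n hn
    have h1 := congrArg (PowerSeries.coeff n) auxC_sq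
    rw [PowerSeries.coeff_mul_eq_coeff_trunc_mul_trunc _ _ hn, ← hp, ← Polynomial.coe_mul,
      Polynomial.coeff_coe] at h1
    rw [Polynomial.coeff_sub, h1, ← Polynomial.coeff_coe]
    simp
  set S : PowerSeries A := Polynomial.aeval Q p with hS
  have hSsum : S = ∑ i ∈ Finset.range (k + 1), auxC i • Q ^ i := by
    have hp' : p = ∑ i ∈ Finset.range (k + 1), Polynomial.monomial i
        (PowerSeries.coeff i (PowerSeries.mk auxC)) := by
      ext n
      simp [hp, PowerSeries.coeff_trunc, Polynomial.coeff_monomial]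
    rw [hS, hp', map_sum]
    refine Finset.sum_congr rfl fun i _ => ?_
    rw [Polynomial.aeval_monomial, PowerSeries.coeff_mk, Algebra.smul_def]
  have hcoeff : ∀ n i, n < i → ∀ T : PowerSeries A, PowerSeries.coeff n (Q ^ i * T) = 0 := by
    intro n i hni T
    rw [hQpow, mul_assoc, PowerSeries.coeff_X_pow_mul', if_neg (by omega)]
  have hSS : S * S = 1 + Q + Q ^ (k + 1) * Polynomial.aeval Q r := by
    have := congrArg (Polynomial.aeval Q) hr
    simp only [map_sub, map_mul, map_add, map_one, map_pow, Polynomial.aeval_X] at this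
    rw [← this, hS]; abel
  have key := aux_sqrt_unique E S k (by simp [hE, hd0]) (by
      rw [hSsum, Finset.sum_range_succ', map_add, map_sum, Finset.sum_eq_zero]
      · simp [auxC]
      · intro i _
        have := hcoeff 0 (i + 1) (by omega) 1
        rw [mul_one] at this
        rw [PowerSeries.coeff_smul, this, smul_zero]) (by
      intro n hn
      rw [hEE, hSS, map_add _ (1 + Q), hcoeff n _ (by omega), add_zero]) k le_rfl
  have hEk : PowerSeries.coeff k E = d (2 * k) := by simp [hE]
  rw [← hEk, key, hSsum, map_sum, Finset.range_eq_Ico, Finset.sum_eq_sum_Ico_succ_bot (by omega)]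
  have h0 : PowerSeries.coeff k (auxC 0 • Q ^ 0) = 0 := by
    simp [auxC, PowerSeries.coeff_one]
    omega
  rw [h0, zero_add]
  refine Finset.sum_congr rfl fun i hi => ?_
  rw [Finset.mem_Icc] at hi
  rw [← auxC_formula i hi.1, aux_shift d i k hi.2, PowerSeries.coeff_smul, hQpow,
    PowerSeries.coeff_X_pow_mul', if_pos hi.2, hP, aux_coeff_pow]
end

section
/- Let E and F be finite-dimensional real inner product spaces. For a subset S of a real inner product space define its polar S° = { y : ⟨x, y⟩ ≥ −1 for all x ∈ S }. Let P ⊆ E and Q ⊆ F be compact convex sets such that 0 lies in the interior of P and 0 lies in the interior of Q. Then, in the product space E × F with inner product ⟨(x,y),(u,v)⟩ = ⟨x,u⟩ + ⟨y,v⟩, one has (P × Q)° = convexHull( (P° × {0}) ∪ ({0} × Q°) ). -/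
open scoped RealInnerProductSpace

/-- The polar `S° = { y : ⟨x, y⟩ ≥ −1 for all x ∈ S }` of a subset `S` of a real inner
product space. -/
def polarSet {E : Type*} [NormedAddCommGroup E] [InnerProductSpace ℝ E] (S : Set E) :
    Set E :=
  {y | ∀ x ∈ S, -1 ≤ ⟪x, y⟫}

lemma eq_zero_of_inner_nonneg {E : Type*} [NormedAddCommGroup E] [InnerProductSpace ℝ E]
    {P : Set E} (hP0 : (0 : E) ∈ interior P) {u : E} (h : ∀ x ∈ P, 0 ≤ ⟪x, u⟫) : u = 0 := by
  obtain ⟨ε, hε, hb⟩ := Metric.mem_nhds_iff.1 (mem_interior_iff_mem_nhds.1 hP0)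
  by_contra hu
  have hn : 0 < ‖u‖ := norm_pos_iff.2 hu
  have hmem : (-(ε / 2 / ‖u‖)) • u ∈ P := by
    apply hb
    rw [mem_ball_zero_iff, norm_smul, norm_neg, Real.norm_of_nonneg (by positivity),
      div_mul_cancel₀ _ hn.ne']
    linarith
  have h1 := h _ hmem
  rw [real_inner_smul_left, real_inner_self_eq_norm_sq] at h1
  have : 0 < ε / 2 / ‖u‖ * ‖u‖ ^ 2 := by positivity
  linarith

lemma smul_mem_polar {E : Type*} [NormedAddCommGroup E] [InnerProductSpace ℝ E]
    {P : Set E} {u : E} {a : ℝ} (ha : 0 < a) (h : ∀ x ∈ P, -a ≤ ⟪x, u⟫) :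
    a⁻¹ • u ∈ polarSet P := by
  intro x hx
  rw [real_inner_smul_right, ← div_eq_inv_mul, le_div_iff₀ ha]
  linarith [h x hx]

/-- Let `P ⊆ E`, `Q ⊆ F` be compact convex sets containing `0` in their interiors, in
finite-dimensional real inner product spaces.  In `E × F` with the inner product
`⟨(x,y),(u,v)⟩ = ⟨x,u⟩ + ⟨y,v⟩` one has
`(P × Q)° = convexHull ℝ ((P° × {0}) ∪ ({0} × Q°))`. -/
theorem statement7 {E F : Type*}
    [NormedAddCommGroup E] [InnerProductSpace ℝ E] [FiniteDimensional ℝ E]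
    [NormedAddCommGroup F] [InnerProductSpace ℝ F] [FiniteDimensional ℝ F]
    (P : Set E) (Q : Set F)
    (hPc : IsCompact P) (hPconv : Convex ℝ P) (hP0 : (0 : E) ∈ interior P)
    (hQc : IsCompact Q) (hQconv : Convex ℝ Q) (hQ0 : (0 : F) ∈ interior Q) :
    {z : E × F | ∀ w ∈ P ×ˢ Q, -1 ≤ ⟪w.1, z.1⟫ + ⟪w.2, z.2⟫} =
      convexHull ℝ ((polarSet P ×ˢ ({0} : Set F)) ∪ (({0} : Set E) ×ˢ polarSet Q)) := by
  have hP0' := interior_subset hP0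
  have hQ0' := interior_subset hQ0
  apply Set.Subset.antisymm
  · rintro ⟨u, v⟩ hz
    have hz' : ∀ x ∈ P, ∀ y ∈ Q, -1 ≤ ⟪x, u⟫ + ⟪y, v⟫ := fun x hx y hy => hz (x, y) ⟨hx, hy⟩
    obtain ⟨x0, hx0, hmin⟩ := hPc.exists_isMinOn ⟨0, hP0'⟩
      (f := fun x : E => ⟪x, u⟫) (by fun_prop)
    have hmin' : ∀ x ∈ P, ⟪x0, u⟫ ≤ ⟪x, u⟫ := fun x hx => hmin hx
    obtain ⟨a, ha⟩ : ∃ a : ℝ, a = -⟪x0, u⟫ := ⟨_, rfl⟩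
    have ha0 : 0 ≤ a := by
      have := hmin' 0 hP0'
      rw [inner_zero_left] at this
      linarith
    have ha1 : a ≤ 1 := by
      have := hz' x0 hx0 0 hQ0'
      rw [inner_zero_left] at this
      linarith
    have hu : ∀ x ∈ P, -a ≤ ⟪x, u⟫ := fun x hx => by linarith [hmin' x hx]
    have hv : ∀ y ∈ Q, -(1 - a) ≤ ⟪y, v⟫ := fun y hy => by linarith [hz' x0 hx0 y hy]
    rcases ha0.eq_or_lt with h | h
    · have : u = 0 := eq_zero_of_inner_nonneg hP0 fun x hx => by linarith [hu x hx]
      exact subset_convexHull ℝ _ (Or.inr ⟨this, fun y hy => by linarith [hv y hy]⟩)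
    rcases ha1.eq_or_lt with h1 | h1
    · have : v = 0 := eq_zero_of_inner_nonneg hQ0 fun y hy => by linarith [hv y hy]
      exact subset_convexHull ℝ _ (Or.inl ⟨fun x hx => by linarith [hu x hx], this⟩)
    have h2 : 0 < 1 - a := by linarith
    have key := (convex_convexHull ℝ
        ((polarSet P ×ˢ ({0} : Set F)) ∪ (({0} : Set E) ×ˢ polarSet Q)))
      (subset_convexHull ℝ _ (Or.inl ⟨smul_mem_polar h hu, rfl⟩ : (a⁻¹ • u, (0 : F)) ∈ _))
      (subset_convexHull ℝ _ (Or.inr ⟨rfl, smul_mem_polar h2 hv⟩ :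
        ((0 : E), (1 - a)⁻¹ • v) ∈ _)) h.le h2.le (by ring)
    simpa [smul_smul, h.ne', h2.ne'] using key
  · apply convexHull_min
    · rintro ⟨u, v⟩ (⟨h1, h2⟩ | ⟨h1, h2⟩) ⟨x, y⟩ ⟨hx, hy⟩
      · have h2 : v = 0 := h2
        subst h2
        simpa using h1 x hx
      · have h1 : u = 0 := h1
        subst h1
        simpa using h2 y hy
    · intro z hz z' hz' s t hs ht hst w hw
      have e1 := mul_le_mul_of_nonneg_left (hz w hw) hs
      have e2 := mul_le_mul_of_nonneg_left (hz' w hw) ht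
      simp only [Prod.fst_add, Prod.snd_add, Prod.smul_fst, Prod.smul_snd, inner_add_right,
        real_inner_smul_right]
      linarith
end

section
/- For every real number t with |t| < (√5 − 1)/2, the family i ↦ (1 − t^i)^{k_i} (indexed by the positive integers i) is multipliable and ∏_{i=1}^{∞} (1 − t^i)^{k_i} = 1 − t − t². Equivalently, 1/(1 − t − t²) = ∑_{n=0}^{∞} c_n t^n = ∏_{i=1}^{∞} (1 − t^i)^{−k_i}, a decomposition of the generating series of the Fibonacci numbers into an absolutely convergent infinite product. -/
/-- A word over a totally ordered alphabet is Lyndon if it is nonempty and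
lexicographically strictly smaller than each of its proper nonempty suffixes
(a proper prefix of a word being smaller than the word itself). -/
def IsLyndon {α : Type*} [LinearOrder α] (w : List α) : Prop :=
  w ≠ [] ∧ ∀ s : List α, s <:+ w → s ≠ [] → s ≠ w → List.Lex (· < ·) w s

/-- `kly n` is the number of Lyndon words over the alphabet `{1, 2}` of weight `n`
(the weight of a word being the sum of its letters). -/
noncomputable def kly (n : ℕ) : ℕ :=
  Nat.card {w : List ℕ // (∀ a ∈ w, a = 1 ∨ a = 2) ∧ w.sum = n ∧ IsLyndon w}

namespace Ly
variable {α : Type*} [LinearOrder α]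

theorem lex_cases {a b : List α} (h : a < b) : a <+: b ∨ ∀ x y, a ++ x < b ++ y := by
  have h' : List.Lex (· < ·) a b := h
  clear h
  induction h' with
  | nil => left; simp
  | rel h => right; intro x y; exact List.Lex.rel h
  | cons h ih =>
    rcases ih with ih | ih
    · left; simpa using ih
    · right; intro x y; exact List.Lex.cons (ih x y)

theorem prefix_lt {a b : List α} (h : b ≠ []) : a < a ++ b := by
  induction a with
  | nil => cases b with
    | nil => exact absurd rfl h
    | cons x y => exact List.Lex.nil
  | cons x a ih => exact List.Lex.cons ih

theorem prefix_le {a b : List α} (h : a <+: b) : a ≤ b := by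
  obtain ⟨c, rfl⟩ := h
  by_cases hc : c = []
  · subst hc; simp
  · exact (prefix_lt hc).le

theorem append_lt {c a b : List α} (h : a < b) : c ++ a < c ++ b := by
  induction c with
  | nil => exact h
  | cons x a ih => exact List.Lex.cons ih

theorem lyn_append {u v : List α} (hu : IsLyndon u) (hv : IsLyndon v) (h : u < v) :
    IsLyndon (u ++ v) := by
  have hne : u ≠ [] := hu.1
  have h1 : u ++ v < v := by
    rcases lex_cases h with h' | h'
    · obtain ⟨c, rfl⟩ := h'
      have hc : c ≠ [] := by rintro rfl; simp at h
      exact append_lt (hv.2 c ⟨u, rfl⟩ hc (by simpa using hne))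
    · simpa using h' v []
  refine ⟨by simp [hne], fun s hs hs0 hs1 => ?_⟩
  obtain ⟨p, hp⟩ := hs
  change u ++ v < s
  rcases List.append_eq_append_iff.1 hp with ⟨a, ha1, ha2⟩ | ⟨a, ha1, ha2⟩
  · skip
    subst ha2
    have hp0 : p ≠ [] := by rintro rfl; simp_all
    by_cases ha : a = []
    · subst ha; simpa using h1
    have h2 : u < a := hu.2 a ⟨p, ha1.symm⟩ ha (by rw [ha1]; simpa using hp0)
    rcases lex_cases h2 with h' | h'
    · have := h'.length_le
      rw [ha1] at this
      simp at this
      exact absurd this hp0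
    · exact h' v v
  · by_cases ha : s = v
    · subst ha; exact h1
    · exact h1.trans (hv.2 s ⟨a, ha2.symm⟩ hs0 ha)

def Fac (ls : List (List α)) : Prop := (∀ l ∈ ls, IsLyndon l) ∧ ls.Pairwise (fun a b => b ≤ a)

theorem fac_ins (ls : List (List α)) : ∀ u : List α, IsLyndon u → Fac ls →
    ∃ ms, Fac ms ∧ ms.flatten = u ++ ls.flatten := by
  induction ls with
  | nil => intro u hu _; exact ⟨[u], ⟨by simpa using hu, by simp⟩, by simp⟩
  | cons l ls ih =>
    intro u hu ⟨h1, h2⟩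
    rcases lt_or_ge u l with h | h
    · obtain ⟨ms, a, b⟩ := ih (u ++ l) (lyn_append hu (h1 l (by simp)) h)
        ⟨fun x hx => h1 x (by simp [hx]), (List.pairwise_cons.1 h2).2⟩
      exact ⟨ms, a, by simp [b]⟩
    · refine ⟨u :: l :: ls, ⟨?_, ?_⟩, by simp⟩
      · intro x hx
        rcases List.mem_cons.1 hx with rfl | hx
        exacts [hu, h1 x hx]
      · refine List.pairwise_cons.2 ⟨?_, h2⟩
        intro x hx
        rcases List.mem_cons.1 hx with rfl | hx
        exacts [h, ((List.pairwise_cons.1 h2).1 x hx).trans h]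

theorem fac_exists (w : List α) : ∃ ls, Fac ls ∧ ls.flatten = w := by
  induction w with
  | nil => exact ⟨[], ⟨by simp, by simp⟩, rfl⟩
  | cons a w ih =>
    obtain ⟨ls, h, rfl⟩ := ih
    refine fac_ins ls [a] ⟨by simp, ?_⟩ h
    intro s hs h0 h1
    exfalso
    rcases List.suffix_cons_iff.1 hs with h | h
    · exact h1 h
    · exact h0 (by simpa using h)

theorem split_flat (ls : List (List α)) : ∀ a b : List α, ls.flatten = a ++ b → a ≠ [] →
    ∃ q l, l ∈ ls ∧ q ≠ [] ∧ q <:+ a ∧ q <+: l := by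
  induction ls with
  | nil => intro a b h ha; simp at h; exact absurd h.1 ha
  | cons l ls ih =>
    intro a b h ha
    rw [List.flatten_cons] at h
    rcases List.append_eq_append_iff.1 h with ⟨c, h1, h2⟩ | ⟨c, h1, h2⟩
    · by_cases hc : c = []
      · subst hc
        exact ⟨a, l, by simp, ha, List.suffix_rfl, by simp [h1]⟩
      · obtain ⟨q, l', e1, e2, e3, e4⟩ := ih c b h2 hc
        exact ⟨q, l', by simp [e1], e2, e3.trans ⟨l, h1.symm⟩, e4⟩
    · exact ⟨a, l, by simp, ha, List.suffix_rfl, ⟨c, h1.symm⟩⟩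

theorem not_longer {l m : List α} {ls : List (List α)} {r : List α} (h : Fac (l :: ls))
    (hm : IsLyndon m) (e : (l :: ls).flatten = m ++ r) : m <+: l := by
  rw [List.flatten_cons] at e
  rcases List.append_eq_append_iff.1 e with ⟨c, h1, h2⟩ | ⟨c, h1, h2⟩
  · by_cases hc : c = []
    · subst hc; simp [h1]
    exfalso
    obtain ⟨q, l', e1, e2, e3, e4⟩ := split_flat ls c r h2 hc
    have hl : l ≠ [] := (h.1 l (by simp)).1
    have hqm : q ≠ m := by
      rintro rfl
      have := e3.length_le
      rw [h1] at this
      simp at this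
      exact hl this
    have a1 : m < q := hm.2 q (e3.trans ⟨l, h1.symm⟩) e2 hqm
    have a2 : q ≤ l' := prefix_le e4
    have a3 : l' ≤ l := (List.pairwise_cons.1 h.2).1 l' e1
    have a4 : l < m := by rw [h1]; exact prefix_lt hc
    exact lt_irrefl _ (((a1.trans_le a2).trans_le a3).trans a4)
  · exact ⟨c, h1.symm⟩

theorem fac_unique {l m : List α} {ls ms : List (List α)} (h : Fac (l :: ls)) (h' : Fac (m :: ms))
    (e : (l :: ls).flatten = (m :: ms).flatten) : l = m := by
  have h1 := not_longer h (h'.1 m (by simp)) (r := ms.flatten) (by simpa using e)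
  have h2 := not_longer h' (h.1 l (by simp)) (r := ls.flatten) (by simpa using e.symm)
  exact h2.eq_of_length_le h1.length_le

def W (S : Finset (List α)) : Set (List α) :=
  {w | ∃ ls, Fac ls ∧ (∀ l ∈ ls, l ∈ S) ∧ ls.flatten = w}

theorem W_empty : W (∅ : Finset (List α)) = {[]} := by
  ext w
  constructor
  · rintro ⟨ls, -, h, rfl⟩
    have : ls = [] := List.eq_nil_iff_forall_not_mem.2 (by simpa using h)
    simp [this]
  · rintro rfl
    exact ⟨[], ⟨by simp, by simp⟩, by simp, rfl⟩

theorem W_insert {m : List α} {S : Finset (List α)} (hm : IsLyndon m) (h : ∀ x ∈ S, x < m) :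
    W (insert m S) = W S ∪ (fun w => m ++ w) '' W (insert m S) := by
  ext w
  constructor
  · rintro ⟨ls, h1, h2, rfl⟩
    cases ls with
    | nil => left; exact ⟨[], ⟨by simp, by simp⟩, by simp, rfl⟩
    | cons l ls =>
      have hf : Fac ls := ⟨fun x hx => h1.1 x (by simp [hx]), (List.pairwise_cons.1 h1.2).2⟩
      by_cases hl : l = m
      · subst hl
        right
        exact ⟨ls.flatten, ⟨ls, hf, fun x hx => h2 x (by simp [hx]), rfl⟩, by simp⟩
      · left
        have hlS : l ∈ S := by
          have := h2 l (by simp)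
          simpa [hl] using this
        refine ⟨l :: ls, h1, ?_, rfl⟩
        intro x hx
        rcases List.mem_cons.1 hx with rfl | hx'
        · exact hlS
        · have := h2 x hx
          rcases Finset.mem_insert.1 this with rfl | h3
          · exact absurd ((List.pairwise_cons.1 h1.2).1 _ hx') (not_le.2 (h l hlS))
          · exact h3
  · rintro (⟨ls, h1, h2, rfl⟩ | ⟨w, ⟨ls, h1, h2, rfl⟩, rfl⟩)
    · exact ⟨ls, h1, fun x hx => by simp [h2 x hx], rfl⟩
    · refine ⟨m :: ls, ⟨?_, List.pairwise_cons.2 ⟨?_, h1.2⟩⟩, ?_, by simp⟩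
      · intro x hx
        rcases List.mem_cons.1 hx with rfl | hx'
        exacts [hm, h1.1 x hx']
      · intro x hx
        rcases Finset.mem_insert.1 (h2 x hx) with rfl | h3
        exacts [le_rfl, (h x h3).le]
      · intro x hx
        rcases List.mem_cons.1 hx with rfl | hx'
        exacts [by simp, h2 x hx']

theorem W_disj {m : List α} {S : Finset (List α)} (hm : IsLyndon m) (h : ∀ x ∈ S, x < m) :
    Disjoint (W S) ((fun w => m ++ w) '' W (insert m S)) := by
  rw [Set.disjoint_left]
  rintro _ ⟨ls, h1, h2, e⟩ ⟨w, ⟨ms, h3, h4, rfl⟩, rfl⟩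
  have hf : Fac (m :: ms) := by
    refine ⟨?_, List.pairwise_cons.2 ⟨?_, h3.2⟩⟩
    · intro x hx
      rcases List.mem_cons.1 hx with rfl | hx'
      exacts [hm, h3.1 x hx']
    · intro x hx
      rcases Finset.mem_insert.1 (h4 x hx) with rfl | h3
      exacts [le_rfl, (h x h3).le]
  cases ls with
  | nil => simp at e; exact hm.1 e.1
  | cons l ls =>
    have := fac_unique h1 hf (by simpa using e)
    subst this
    exact lt_irrefl _ (h l (h2 l (by simp)))

theorem prod_fin (F : List α → ℝ) (h0 : F [] = 1) (hmul : ∀ u v, F (u ++ v) = F u * F v)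
    (hs : Summable F) (S : Finset (List α)) : (∀ l ∈ S, IsLyndon l) →
    (∑' w : W S, F w) * ∏ l ∈ S, (1 - F l) = 1 := by
  classical
  induction S using Finset.induction_on_max with
  | empty => intro _; rw [W_empty]; simp [h0]
  | insert m S h ih =>
    intro hL
    have hm := hL m (by simp)
    have ih := ih (fun l hl => hL l (by simp [hl]))
    have hn : m ∉ S := fun hh => lt_irrefl _ (h m hh)
    rw [Finset.prod_insert hn]
    have e : ∑' w : W (insert m S), F w = ∑' w : W S, F w + F m * ∑' w : W (insert m S), F w := by
      conv_lhs => rw [W_insert hm h]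
      rw [Summable.tsum_union_disjoint (W_disj hm h) (hs.subtype _) (hs.subtype _),
        tsum_image (g := fun w => m ++ w) F (fun a _ b _ hab => List.append_cancel_left hab)]
      simp only [hmul]
      rw [tsum_mul_left]
    have e2 : (∑' w : W (insert m S), F w) * (1 - F m) = ∑' w : W S, F w := by linarith
    rw [← mul_assoc, e2, ih]

theorem prod_all (F : List α → ℝ) (h0 : F [] = 1) (hmul : ∀ u v, F (u ++ v) = F u * F v)
    (A : ℝ) (hA : A ≠ 0) (hs : HasSum F A) :
    HasProd (fun l : {l : List α // IsLyndon l} => 1 - F l) A⁻¹ := by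
  classical
  have key : ∀ s : Finset {l : List α // IsLyndon l},
      ∏ l ∈ s, (1 - F l) = (∑' w, (W (s.map (Function.Embedding.subtype _))).indicator F w)⁻¹ := by
    intro s
    have := prod_fin F h0 hmul hs.summable (s.map (Function.Embedding.subtype _)) (by
      intro l hl; simp at hl; exact hl.1)
    rw [Finset.prod_map, tsum_subtype] at this
    exact eq_inv_of_mul_eq_one_right this
  unfold HasProd
  simp only [SummationFilter.unconditional_filter]
  simp_rw [key]
  refine Filter.Tendsto.inv₀ ?_ hA
  rw [← hs.tsum_eq]
  refine tendsto_tsum_of_dominated_convergence hs.summable.norm ?_ ?_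
  · intro w
    obtain ⟨ls, h1, rfl⟩ := fac_exists w
    refine tendsto_const_nhds.congr' ?_
    have := Filter.eventually_ge_atTop (ls.attach.map (fun l => (⟨l.1, h1.1 l.1 l.2⟩ : {l : List α // IsLyndon l}))).toFinset
    filter_upwards [this] with s hs'
    rw [Set.indicator_of_mem]
    refine ⟨ls, h1, ?_, rfl⟩
    intro l hl
    simp only [Finset.mem_map, Function.Embedding.subtype_apply]
    refine ⟨⟨l, h1.1 l hl⟩, hs' ?_, rfl⟩
    simp [hl]
  · filter_upwards with s w
    exact norm_indicator_le_norm_self _ _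


noncomputable def ff (t : ℝ) (a : ℕ) : ℝ := if a = 1 ∨ a = 2 then t ^ a else 0

noncomputable def FF (t : ℝ) (w : List ℕ) : ℝ := (w.map (ff t)).prod

theorem FF_good (t : ℝ) {w : List ℕ} (h : ∀ a ∈ w, a = 1 ∨ a = 2) : FF t w = t ^ w.sum := by
  induction w with
  | nil => simp [FF]
  | cons a w ih =>
    have := ih (fun x hx => h x (by simp [hx]))
    unfold FF at this ⊢
    rw [List.map_cons, List.prod_cons, this, ff, if_pos (h a (by simp)), List.sum_cons, pow_add]

theorem FF_bad (t : ℝ) {w : List ℕ} (h : ¬ ∀ a ∈ w, a = 1 ∨ a = 2) : FF t w = 0 := by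
  push Not at h
  obtain ⟨a, ha, h1⟩ := h
  refine List.prod_eq_zero (List.mem_map.2 ⟨a, ha, ?_⟩)
  rw [ff, if_neg (by tauto)]

abbrev A2 : Set ℕ := ↑({1, 2} : Finset ℕ)

theorem sum_tuple (t : ℝ) (n : ℕ) :
    ∑ p : Fin n → A2, FF t ((List.ofFn p).map (↑)) = (t + t ^ 2) ^ n := by
  have h : ∑ a : A2, ff t a = t + t ^ 2 := by
    refine (Finset.sum_coe_sort ({1, 2} : Finset ℕ) (ff t)).trans ?_
    simp [ff]
  rw [← h, Fintype.sum_pow]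
  refine Finset.sum_congr rfl fun p _ => ?_
  simp [FF, List.map_ofFn, List.prod_ofFn]

theorem bad_zero (t : ℝ) : ∀ x, x ∉ Set.range (List.map ((↑) : A2 → ℕ)) → FF t x = 0 := by
  intro x hx
  refine FF_bad t fun h => hx ?_
  rw [Set.range_list_map_coe]
  intro a ha
  simpa using h a ha

theorem FF_nonneg {t : ℝ} (h : 0 ≤ t) (w : List ℕ) : 0 ≤ FF t w := by
  by_cases hw : ∀ a ∈ w, a = 1 ∨ a = 2
  · rw [FF_good t hw]; positivity
  · rw [FF_bad t hw]

theorem FF_abs (t : ℝ) (w : List ℕ) : FF |t| w = ‖FF t w‖ := by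
  by_cases hw : ∀ a ∈ w, a = 1 ∨ a = 2
  · rw [FF_good t hw, FF_good _ hw]; simp
  · rw [FF_bad t hw, FF_bad _ hw]; simp

theorem inj_map : Function.Injective (List.map ((↑) : A2 → ℕ)) :=
  List.map_injective_iff.2 Subtype.val_injective

theorem summable_FF {t : ℝ} (h : 0 ≤ t) (h1 : t + t ^ 2 < 1) : Summable (FF t) := by
  rw [← inj_map.summable_iff (bad_zero t), ← List.equivSigmaTuple.symm.summable_iff]
  refine (summable_sigma_of_nonneg (fun x => FF_nonneg h _)).2 ⟨fun n => (hasSum_fintype _).summable, ?_⟩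
  have : ∀ n : ℕ, ∑' p : Fin n → A2, FF t ((List.ofFn p).map (↑)) = (t + t ^ 2) ^ n := by
    intro n
    rw [tsum_fintype, sum_tuple]
  refine (summable_geometric_of_lt_one (by positivity) h1).congr fun n => ?_
  exact (this n).symm

theorem hasSum_FF {t : ℝ} (h1 : |t| + |t| ^ 2 < 1) : HasSum (FF t) (1 - t - t ^ 2)⁻¹ := by
  have hs : Summable (FF t) := by
    refine Summable.of_norm ?_
    exact (summable_FF (abs_nonneg t) h1).congr fun w => (FF_abs t w)
  have h2 : |t + t ^ 2| < 1 := by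
    refine (abs_add_le _ _).trans_lt ?_
    simpa [abs_pow] using h1
  have h3 := hs.hasSum
  rw [← inj_map.hasSum_iff (bad_zero t), ← List.equivSigmaTuple.symm.hasSum_iff] at h3
  have h4 := h3.sigma (g := fun n => (t + t ^ 2) ^ n) (fun n => by
    rw [← sum_tuple]
    exact hasSum_fintype _)
  have h5 := h4.unique (hasSum_geometric_of_abs_lt_one h2)
  have h6 := hs.hasSum
  rw [h5] at h6
  convert h6 using 2
  ring

theorem fin_weight (n : ℕ) : {w : List ℕ | (∀ a ∈ w, a = 1 ∨ a = 2) ∧ w.sum = n}.Finite := by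
  have hs : Summable (FF (1/2)) := summable_FF (by norm_num) (by norm_num)
  have := hs.tendsto_cofinite_zero.eventually (gt_mem_nhds (show (0:ℝ) < (1/2) ^ n by positivity))
  rw [Filter.eventually_cofinite] at this
  refine this.subset ?_
  rintro w ⟨h1, h2⟩
  simp only [Set.mem_ofPred_eq, FF_good _ h1, h2, lt_irrefl, not_false_eq_true]

abbrev L12 (n : ℕ) := {w : List ℕ // (∀ a ∈ w, a = 1 ∨ a = 2) ∧ w.sum = n ∧ IsLyndon w}

def toLyn (x : Σ i : ℕ, L12 (i + 1)) : {l : List ℕ // IsLyndon l} := ⟨x.2.1, x.2.2.2.2⟩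

theorem toLyn_inj : Function.Injective toLyn := by
  rintro ⟨i, w, h1, h2, h3⟩ ⟨j, v, h4, h5, h6⟩ h
  have : w = v := congrArg Subtype.val h
  subst this
  have : i = j := by omega
  subst this
  rfl

theorem toLyn_range {l : {l : List ℕ // IsLyndon l}} (h : ∀ a ∈ l.1, a = 1 ∨ a = 2) :
    l ∈ Set.range toLyn := by
  obtain ⟨l, hl⟩ := l
  have : l.sum ≠ 0 := by
    intro h0
    rw [List.sum_eq_zero_iff] at h0
    obtain ⟨a, ha⟩ := List.exists_mem_of_ne_nil l hl.1
    have := h a ha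
    have := h0 a ha
    omega
  exact ⟨⟨l.sum - 1, ⟨l, h, by omega, hl⟩⟩, rfl⟩

theorem main {t : ℝ} (h1 : |t| + |t| ^ 2 < 1) :
    HasProd (fun i : ℕ => (1 - t ^ (i + 1)) ^ kly (i + 1)) (1 - t - t ^ 2) := by
  have h0 : 1 - t - t ^ 2 ≠ 0 := by
    have := le_abs_self t
    rw [sq_abs] at h1
    intro h; linarith
  have hp := prod_all (FF t) (by simp [FF]) (by simp [FF]) _ (inv_ne_zero h0) (hasSum_FF h1)
  rw [inv_inv, ← toLyn_inj.hasProd_iff] at hp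
  · refine hp.sigma fun i => ?_
    have : Finite (L12 (i + 1)) :=
      ((fin_weight (i + 1)).subset (fun w h => ⟨h.1, h.2.1⟩) :
        {w : List ℕ | (∀ a ∈ w, a = 1 ∨ a = 2) ∧ w.sum = i + 1 ∧ IsLyndon w}.Finite)
    have := Fintype.ofFinite (L12 (i + 1))
    have e := hasProd_fintype (fun _ : L12 (i + 1) => (1 - t ^ (i + 1)))
    rw [Finset.prod_const, Finset.card_univ, ← Nat.card_eq_fintype_card] at e
    convert! e using 2 with c
    simp only [toLyn, Function.comp]
    rw [FF_good t c.2.1, c.2.2.1]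
  · intro l hl
    rw [FF_bad t (fun h => hl (toLyn_range h)), sub_zero]

end Ly

/-- For every real `t` with `|t| < (√5 − 1)/2`, the family `i ↦ (1 − t^i)^{k_i}` (over
positive integers `i`) is multipliable with `∏_{i≥1} (1 − t^i)^{k_i} = 1 − t − t²`;
equivalently, the generating series of the Fibonacci numbers decomposes as the absolutely
convergent infinite product `1/(1−t−t²) = ∏_{i≥1} (1 − t^i)^{−k_i}`. -/
theorem statement9 (t : ℝ) (ht : |t| < (Real.sqrt 5 - 1) / 2) :
    Multipliable (fun i : ℕ => (1 - t ^ (i + 1)) ^ kly (i + 1)) ∧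
      ∏' i : ℕ, (1 - t ^ (i + 1)) ^ kly (i + 1) = 1 - t - t ^ 2 := by
  have h5 : Real.sqrt 5 ^ 2 = 5 := Real.sq_sqrt (by norm_num)
  have h : |t| + |t| ^ 2 < 1 := by nlinarith [abs_nonneg t, Real.sqrt_nonneg 5]
  exact ⟨(Ly.main h).multipliable, (Ly.main h).tprod_eq⟩
end

section
/- For every prime number p, the number k_p of Lyndon words over the alphabet {1,2} of weight p satisfies, as an identity of rational numbers, k_p = ∑_{j=1}^{⌊p/2⌋} binom(p−j, j) / (p−j). -/
namespace LyndonAux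

/-- Words over `{1,2}` of length `n` with `j` letters equal to `2`. -/
def W : ℕ → ℕ → Finset (List ℕ)
  | 0, 0 => {[]}
  | 0, _ + 1 => ∅
  | n + 1, 0 => (W n 0).image (List.cons 1)
  | n + 1, j + 1 => (W n (j + 1)).image (List.cons 1) ∪ (W n j).image (List.cons 2)

theorem card_W (n j : ℕ) : (W n j).card = n.choose j := by
  induction n generalizing j with
  | zero => cases j <;> simp [W]
  | succ n ih =>
    cases j with
    | zero =>
      rw [W, Finset.card_image_of_injective _ List.cons_injective, ih]; simp
    | succ j =>
      rw [W, Finset.card_union_of_disjoint,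
        Finset.card_image_of_injective _ List.cons_injective,
        Finset.card_image_of_injective _ List.cons_injective, ih, ih, Nat.choose_succ_succ, add_comm]
      rw [Finset.disjoint_left]
      intro x hx hy
      simp only [Finset.mem_image] at hx hy
      obtain ⟨a, -, rfl⟩ := hx
      obtain ⟨b, -, hb⟩ := hy
      simp at hb

theorem length_le_sum (w : List ℕ) (h : ∀ a ∈ w, a = 1 ∨ a = 2) :
    w.length ≤ w.sum ∧ w.sum ≤ 2 * w.length := by
  induction w with
  | nil => simp
  | cons a w ih =>
    have h1 := h a (by simp)
    have h2 := ih (fun b hb => h b (by simp [hb]))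
    simp only [List.length_cons, List.sum_cons]
    omega

theorem mem_W (n j : ℕ) (w : List ℕ) :
    w ∈ W n j ↔ (∀ a ∈ w, a = 1 ∨ a = 2) ∧ w.length = n ∧ w.sum = n + j := by
  induction n generalizing j w with
  | zero =>
    cases j with
    | zero =>
      simp only [W, Finset.mem_singleton]
      constructor
      · rintro rfl; simp
      · rintro ⟨-, h, -⟩; exact List.length_eq_zero_iff.1 h
    | succ j =>
      simp only [W, Finset.notMem_empty, false_iff]
      rintro ⟨-, h, h'⟩
      rw [List.length_eq_zero_iff.1 h] at h'
      simp at h'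
  | succ n ih =>
    rcases w with _ | ⟨a, w⟩
    · cases j <;> simp [W]
    · have key := length_le_sum w
      cases j with
      | zero =>
        simp only [W, Finset.mem_image, ih, List.cons.injEq, List.mem_cons, forall_eq_or_imp,
          List.length_cons, List.sum_cons]
        constructor
        · rintro ⟨b, ⟨h1, h2, h3⟩, rfl, rfl⟩
          exact ⟨⟨by simp, h1⟩, by omega, by omega⟩
        · rintro ⟨⟨h0, h1⟩, h2, h3⟩
          have := key h1
          exact ⟨w, ⟨h1, by omega, by omega⟩, by omega, rfl⟩
      | succ j =>
        simp only [W, Finset.mem_union, Finset.mem_image, ih, List.cons.injEq, List.mem_cons,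
          forall_eq_or_imp, List.length_cons, List.sum_cons]
        constructor
        · rintro (⟨b, ⟨h1, h2, h3⟩, rfl, rfl⟩ | ⟨b, ⟨h1, h2, h3⟩, rfl, rfl⟩)
          · exact ⟨⟨by simp, h1⟩, by omega, by omega⟩
          · exact ⟨⟨by simp, h1⟩, by omega, by omega⟩
        · rintro ⟨⟨h0 | h0, h1⟩, h2, h3⟩
          · exact Or.inl ⟨w, ⟨h1, by omega, by omega⟩, by omega, rfl⟩
          · exact Or.inr ⟨w, ⟨h1, by omega, by omega⟩, by omega, rfl⟩

theorem commute_aux (N : ℕ) (u v : List ℕ) (hN : u.length + v.length ≤ N) (h : u ++ v = v ++ u) :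
    ∃ s l a b : ℕ, u.sum = a * s ∧ u.length = a * l ∧ v.sum = b * s ∧ v.length = b * l := by
  induction N generalizing u v with
  | zero =>
    have hu : u = [] := List.length_eq_zero_iff.1 (by omega)
    have hv : v = [] := List.length_eq_zero_iff.1 (by omega)
    subst hu hv
    exact ⟨0, 0, 0, 0, by simp⟩
  | succ N ih =>
    rcases Nat.eq_zero_or_pos u.length with hu | hu
    · rw [List.length_eq_zero_iff.1 hu]
      exact ⟨v.sum, v.length, 0, 1, by simp⟩
    rcases Nat.eq_zero_or_pos v.length with hv | hv
    · rw [List.length_eq_zero_iff.1 hv]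
      exact ⟨u.sum, u.length, 1, 0, by simp⟩
    rcases le_total u.length v.length with hl | hl
    · obtain ⟨t, rfl⟩ : u <+: v :=
        List.prefix_of_prefix_length_le (List.prefix_append u v) (h ▸ List.prefix_append v u) hl
      have h' : u ++ t = t ++ u := by
        rw [List.append_assoc] at h
        exact List.append_cancel_left h
      obtain ⟨s, l, a, b, h1, h2, h3, h4⟩ := ih u t (by simp at hN; omega) h'
      exact ⟨s, l, a, a + b, h1, h2, by simp [h1, h3, add_mul], by simp [h2, h4, add_mul]⟩
    · obtain ⟨t, rfl⟩ : v <+: u :=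
        List.prefix_of_prefix_length_le (List.prefix_append v u) (h ▸ List.prefix_append u v) hl
      have h' : t ++ v = v ++ t := by
        rw [List.append_assoc] at h
        exact List.append_cancel_left h
      obtain ⟨s, l, a, b, h1, h2, h3, h4⟩ := ih t v (by simp at hN; omega) h'
      exact ⟨s, l, b + a, b, by simp [h1, h3, add_mul], by simp [h2, h4, add_mul], h3, h4⟩

theorem rotate_ne (p : ℕ) (hp : p.Prime) (w : List ℕ) (hs : w.sum = p) (hl : w.length < p)
    (i : ℕ) (hi : 0 < i) (hi' : i < w.length) : w.rotate i ≠ w := by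
  intro h
  rw [List.rotate_eq_drop_append_take hi'.le] at h
  have h' : w.take i ++ w.drop i = w.drop i ++ w.take i := by rw [h, List.take_append_drop]
  obtain ⟨s, l, a, b, h1, h2, h3, h4⟩ := commute_aux _ _ _ le_rfl h'
  have e1 : w.sum = (a + b) * s := by
    conv_lhs => rw [← List.take_append_drop i w]
    rw [List.sum_append, h1, h3, add_mul]
  simp only [List.length_take, List.length_drop] at h2 h4
  have ha : a ≠ 0 := by rintro rfl; omega
  have hb : b ≠ 0 := by rintro rfl; omega
  have e2 : w.length = (a + b) * l := by rw [add_mul]; omega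
  have hd : a + b ∣ p := ⟨s, by rw [← hs, e1]⟩
  have hl0 : 0 < l := by
    rcases Nat.eq_zero_or_pos l with rfl | h0
    · omega
    · exact h0
  rcases (Nat.dvd_prime hp).1 hd with h0 | h0
  · omega
  · rw [h0] at e2
    have := Nat.le_mul_of_pos_right p hl0
    omega

theorem lt_append_right (a b c : List ℕ) (h : List.Lex (· < ·) a b) : a < b ++ c := by
  induction h with
  | nil => exact List.Lex.nil
  | rel h => exact List.Lex.rel h
  | cons h ih => exact List.Lex.cons ih

theorem append_lt_left (a b c : List ℕ) (h : b < c) : a ++ b < a ++ c := by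
  induction a with
  | nil => simpa
  | cons x a ih => exact List.Lex.cons ih

/-- If `a < b` and `a` is not a prefix of `b`, the difference is strict. -/
theorem append_lt_append (a b : List ℕ) (h : List.Lex (· < ·) a b) (hn : ¬ a <+: b)
    (c d : List ℕ) : a ++ c < b ++ d := by
  induction h with
  | nil => simp at hn
  | rel h => exact List.Lex.rel h
  | cons h ih => exact List.Lex.cons (ih (fun h => hn (by simpa using h)))

theorem lyndon_rotate_lt (w : List ℕ) (h : IsLyndon w) (i : ℕ) (hi : 0 < i) (hi' : i < w.length) :
    w < w.rotate i := by
  rw [List.rotate_eq_drop_append_take hi'.le]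
  apply lt_append_right
  apply h.2 _ (List.drop_suffix i w)
  · intro h0
    have := congrArg List.length h0
    simp at this; omega
  · intro h0
    have := congrArg List.length h0
    simp at this; omega

theorem lyndon_of_rotate_lt (w : List ℕ) (hw : w ≠ [])
    (h : ∀ i, 0 < i → i < w.length → w < w.rotate i) : IsLyndon w := by
  refine ⟨hw, ?_⟩
  rintro v ⟨u, rfl⟩ hv hne
  have hu : u ≠ [] := by rintro rfl; simp at hne
  have hu' := List.length_pos_iff.2 hu
  have hv' := List.length_pos_iff.2 hv
  have h1 : u ++ v < v ++ u := by
    have := h u.length hu' (by simp; omega)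
    rwa [List.rotate_append_length_eq] at this
  by_contra hcon
  have hlt : v < u ++ v := lt_of_le_of_ne (not_lt.1 hcon) hne
  by_cases hpre : v <+: u ++ v
  · obtain ⟨t, ht⟩ := hpre
    have hlen : t.length = u.length := by
      have := congrArg List.length ht
      simp at this; omega
    have h2 : t < u := by
      by_contra h3
      rcases (not_lt.1 h3).lt_or_eq with h4 | h4
      · have := append_lt_left v _ _ h4
        rw [ht] at this
        exact lt_asymm this h1
      · subst h4; rw [ht] at h1; exact lt_irrefl _ h1
    have h3 : t ++ v < u ++ v := append_lt_append t u h2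
      (fun hp => h2.ne (hp.eq_of_length hlen)) v v
    have h4 := h v.length hv' (by simp; omega)
    conv at h4 => rhs; rw [← ht]
    rw [List.rotate_append_length_eq] at h4
    exact lt_asymm h3 h4
  · have := append_lt_append v (u ++ v) hlt hpre u []
    rw [List.append_nil] at this
    exact lt_asymm this h1

open Classical in
theorem count (p : ℕ) (hp : p.Prime) (n j : ℕ) (hnj : n + j = p) (hj : 0 < j) (hn : 0 < n) :
    ((W n j).filter IsLyndon).card * n = n.choose j := by
  rw [← card_W]
  rw [show ((W n j).filter IsLyndon).card * n =
    ((W n j).filter IsLyndon ×ˢ Finset.range n).card by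
      rw [Finset.card_product, Finset.card_range]]
  have rot : ∀ w ∈ W n j, ∀ i, w.rotate i ∈ W n j := by
    intro w hw i
    rw [mem_W] at hw ⊢
    refine ⟨fun a ha => hw.1 a (List.mem_rotate.1 ha), by simpa using hw.2.1, ?_⟩
    rw [(List.rotate_perm w i).sum_eq]
    exact hw.2.2
  refine Finset.card_bij (fun x _ => x.1.rotate x.2) ?_ ?_ ?_
  · rintro ⟨w, i⟩ h
    simp only [Finset.mem_product, Finset.mem_filter] at h
    exact rot w h.1.1 i
  · rintro ⟨w, i⟩ h ⟨w', i'⟩ h' heq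
    simp only [Finset.mem_product, Finset.mem_filter, Finset.mem_range, mem_W] at h h'
    obtain ⟨⟨⟨-, hl, -⟩, hL⟩, hi⟩ := h
    obtain ⟨⟨⟨-, hl', -⟩, hL'⟩, hi'⟩ := h'
    dsimp only at heq
    -- a general comparison
    have gen : ∀ (w w' : List ℕ) (i i' : ℕ), w.length = n → w'.length = n → IsLyndon w → i < n →
        i' < n → w.rotate i = w'.rotate i' → w ≤ w' ∧ (i ≠ i' → w < w') := by
      intro w w' i i' hl hl' hL hi hi' heq
      have e : w' = w.rotate (i + (n - i')) := by
        rw [← List.rotate_rotate, heq, List.rotate_rotate,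
          show i' + (n - i') = w'.length by omega, List.rotate_length]
      rcases lt_trichotomy i i' with hlt | rfl | hlt
      · have := lyndon_rotate_lt w hL (i + (n - i')) (by omega) (by omega)
        rw [← e] at this
        exact ⟨this.le, fun _ => this⟩
      · rw [show i + (n - i) = w.length by omega, List.rotate_length] at e
        exact ⟨e.ge, fun h => absurd rfl h⟩
      · rw [← List.rotate_mod, hl, show i + (n - i') = (i - i') + n by omega, Nat.add_mod_right,
          Nat.mod_eq_of_lt (by omega)] at e
        have := lyndon_rotate_lt w hL (i - i') (by omega) (by omega)
        rw [← e] at this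
        exact ⟨this.le, fun _ => this⟩
    have g1 := gen w w' i i' hl hl' hL hi hi' heq
    have g2 := gen w' w i' i hl' hl hL' hi' hi heq.symm
    have hw : w = w' := le_antisymm g1.1 g2.1
    have hii : i = i' := by
      by_contra hne
      have := g1.2 hne
      rw [hw] at this
      exact lt_irrefl _ this
    rw [hw, hii]
  · intro x hx
    obtain ⟨k, hk, hmin⟩ := Finset.exists_min_image (Finset.range n) (fun i => x.rotate i)
      ⟨0, Finset.mem_range.2 hn⟩
    rw [Finset.mem_range] at hk
    have hwW := rot x hx k
    have hxl := ((mem_W _ _ _).1 hx).2.1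
    obtain ⟨-, hwl, hws⟩ := (mem_W _ _ _).1 hwW
    have hL : IsLyndon (x.rotate k) := by
      apply lyndon_of_rotate_lt
      · intro h0; rw [h0] at hwl; simp at hwl; omega
      · intro i hi hi'
        refine lt_of_le_of_ne ?_ (rotate_ne p hp _ (by omega) (by omega) i hi hi').symm
        rw [List.rotate_rotate, ← List.rotate_mod x (k + i), hxl]
        exact hmin _ (Finset.mem_range.2 (Nat.mod_lt _ hn))
    refine ⟨(x.rotate k, (n - k) % n), ?_, ?_⟩
    · simp only [Finset.mem_product, Finset.mem_filter, Finset.mem_range]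
      exact ⟨⟨hwW, hL⟩, Nat.mod_lt _ hn⟩
    · dsimp only
      conv_lhs => rw [← hwl]
      rw [List.rotate_mod, List.rotate_rotate, hwl, show k + (n - k) = x.length by omega,
        List.rotate_length]

theorem length_lt (p : ℕ) (hp : p.Prime) (w : List ℕ) (h : ∀ a ∈ w, a = 1 ∨ a = 2)
    (hs : w.sum = p) (hL : IsLyndon w) : w.length < p := by
  have h1 := length_le_sum w h
  by_contra hcon
  have hl : w.length = p := by omega
  have key : ∀ w : List ℕ, (∀ a ∈ w, a = 1 ∨ a = 2) → w.sum = w.length →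
      w = List.replicate w.length 1 := by
    intro w h hs
    induction w with
    | nil => rfl
    | cons a w ih =>
      have h1 := h a (by simp)
      have h2 : ∀ b ∈ w, b = 1 ∨ b = 2 := fun b hb => h b (by simp [hb])
      have h3 := length_le_sum w h2
      simp only [List.sum_cons, List.length_cons] at hs
      rw [List.length_cons, List.replicate_succ, ← ih h2 (by omega), show a = 1 by omega]
  have e := key w h (by omega)
  have := lyndon_rotate_lt w hL 1 one_pos (by rw [hl]; exact hp.one_lt)
  rw [e, List.rotate_replicate] at this
  exact lt_irrefl _ this

end LyndonAux

/-- For every prime `p`, `k_p = ∑_{j=1}^{⌊p/2⌋} C(p−j, j) / (p−j)` as rational numbers. -/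
theorem statement10 (p : ℕ) (hp : p.Prime) :
    (kly p : ℚ) = ∑ j ∈ Finset.Icc 1 (p / 2), (Nat.choose (p - j) j : ℚ) / ((p - j : ℕ) : ℚ) := by
  classical
  have hp2 := hp.two_le
  have h1 : kly p = ((Finset.Icc 1 (p / 2)).biUnion
      (fun j => (LyndonAux.W (p - j) j).filter IsLyndon)).card := by
    unfold kly
    apply Nat.subtype_card
    intro w
    simp only [Finset.mem_biUnion, Finset.mem_Icc, Finset.mem_filter, LyndonAux.mem_W]
    constructor
    · rintro ⟨j, ⟨hj1, hj2⟩, ⟨ha, hb, hc⟩, hL⟩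
      exact ⟨ha, by omega, hL⟩
    · rintro ⟨ha, hs, hL⟩
      have := LyndonAux.length_lt p hp w ha hs hL
      have := LyndonAux.length_le_sum w ha
      exact ⟨p - w.length, by omega, ⟨ha, by omega, by omega⟩, hL⟩
  rw [h1, Finset.card_biUnion]
  · push_cast
    apply Finset.sum_congr rfl
    intro j hj
    rw [Finset.mem_Icc] at hj
    rw [eq_div_iff (by norm_cast; omega)]
    exact_mod_cast LyndonAux.count p hp (p - j) j (by omega) (by omega) (by omega)
  · intro i hi j hj hij
    rw [Function.onFun, Finset.disjoint_left]
    intro w hw hw'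
    rw [Finset.mem_coe, Finset.mem_Icc] at hi hj
    simp only [Finset.mem_filter, LyndonAux.mem_W] at hw hw'
    omega
end

section
/- For every n ≥ 1, k_{n+1} ≥ k_n; that is, the number of Lyndon words over the alphabet {1,2} of weight n+1 is at least the number of Lyndon words over {1,2} of weight n. -/
/-- Prepending `1` to a Lyndon word over `{1, 2}` other than `[1]` gives a larger-weight Lyndon word. -/
theorem lyndon_cons_one (w : List ℕ) (hA : ∀ a ∈ w, a = 1 ∨ a = 2) (hL : IsLyndon w)
    (h1 : w ≠ [1]) : IsLyndon (1 :: w) := by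
  obtain ⟨hne, hs⟩ := hL
  have key : (1 :: w) < w := by
    cases w with
    | nil => exact absurd rfl hne
    | cons a t =>
      rcases hA a (by simp) with rfl | rfl
      · have ht : t ≠ [] := by rintro rfl; exact h1 rfl
        exact List.Lex.cons (hs t (List.suffix_cons _ _) ht (by simp))
      · exact List.Lex.rel (by norm_num)
  refine ⟨by simp, fun s hsuf hsne hsw => ?_⟩
  rcases List.suffix_cons_iff.1 hsuf with h | h
  · exact absurd h hsw
  · by_cases e : s = w
    · subst e; exact key
    · have h2 : w < s := hs s h hsne e
      exact lt_trans key h2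

theorem lyndon_two : IsLyndon [2] := by
  refine ⟨by simp, fun s hsuf hsne hsw => ?_⟩
  rcases List.suffix_cons_iff.1 hsuf with h | h
  · exact absurd h hsw
  · exact absurd (List.suffix_nil.1 h) hsne

theorem lyndon_finite (n : ℕ) :
    Finite {w : List ℕ // (∀ a ∈ w, a = 1 ∨ a = 2) ∧ w.sum = n ∧ IsLyndon w} := by
  let g : {w : List ℕ // (∀ a ∈ w, a = 1 ∨ a = 2) ∧ w.sum = n ∧ IsLyndon w} → Composition n :=
    fun w => ⟨w.1, fun {i} hi => by rcases w.2.1 i hi with h | h <;> omega, w.2.2.1⟩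
  refine Finite.of_injective g fun x y h => ?_
  exact Subtype.ext (congrArg Composition.blocks h)

/-- For every `n ≥ 1`, `k_{n+1} ≥ k_n`. -/
theorem statement12 (n : ℕ) (hn : 1 ≤ n) : kly n ≤ kly (n + 1) := by
  have := lyndon_finite (n + 1)
  let f : {w : List ℕ // (∀ a ∈ w, a = 1 ∨ a = 2) ∧ w.sum = n ∧ IsLyndon w} →
      {w : List ℕ // (∀ a ∈ w, a = 1 ∨ a = 2) ∧ w.sum = n + 1 ∧ IsLyndon w} := fun w =>
    ⟨if w.1 = [1] then [2] else 1 :: w.1, by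
      obtain ⟨w, hA, hsum, hL⟩ := w
      dsimp only
      split_ifs with h
      · subst h
        refine ⟨by simp, ?_, lyndon_two⟩
        simp at hsum ⊢
        omega
      · refine ⟨?_, ?_, lyndon_cons_one w hA hL h⟩
        · intro a ha
          rcases List.mem_cons.1 ha with h | h
          · exact Or.inl h
          · exact hA a h
        · rw [List.sum_cons, hsum, add_comm]⟩
  refine Nat.card_le_card_of_injective f fun x y h => ?_
  have h' := congrArg Subtype.val h
  apply Subtype.ext
  dsimp only [f] at h'
  split_ifs at h' with h1 h2 h2
  · rw [h1, h2]
  · simp at h'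
  · simp at h'
  · exact (List.cons.inj h').2
end

section
/- For every n ≥ 1, the number of Lyndon words over the alphabet of odd positive integers of weight n is at least N_n − 2, where N_n is the number of partitions of n into odd parts. -/
/-- The number of Lyndon words over the alphabet of odd positive integers of weight `n`. -/
noncomputable def klyOdd (n : ℕ) : ℕ :=
  Nat.card {w : List ℕ // (∀ a ∈ w, Odd a) ∧ w.sum = n ∧ IsLyndon w}

theorem lex_aux {m y : ℕ} (hy : m < y) (X Y : List ℕ) : ∀ (c a : ℕ), c < a →
    List.Lex (· < ·) (List.replicate a m ++ X) (List.replicate c m ++ y :: Y) := by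
  intro c
  induction c with
  | zero =>
    intro a ha
    obtain ⟨a, rfl⟩ : ∃ a', a = a' + 1 := ⟨a - 1, by omega⟩
    simpa [List.replicate_succ] using List.Lex.rel hy
  | succ c ih =>
    intro a ha
    obtain ⟨a, rfl⟩ : ∃ a', a = a' + 1 := ⟨a - 1, by omega⟩
    simp only [List.replicate_succ, List.cons_append]
    exact List.Lex.cons (ih a (by omega))

theorem suffix_aux (m : ℕ) (s Y : List ℕ) : ∀ a : ℕ, s <:+ List.replicate a m ++ Y →
    s <:+ Y ∨ ∃ c ≤ a, s = List.replicate c m ++ Y := by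
  intro a
  induction a with
  | zero => intro h; left; simpa using h
  | succ a ih =>
    intro h
    rw [List.replicate_succ, List.cons_append, List.suffix_cons_iff] at h
    rcases h with h | h
    · right
      exact ⟨a + 1, le_rfl, by simpa [List.replicate_succ] using h⟩
    · rcases ih h with h | ⟨c, hc, h⟩
      · exact Or.inl h
      · exact Or.inr ⟨c, by omega, h⟩

theorem lyndon_sorted (m a : ℕ) (Y : List ℕ) (ha : 1 ≤ a) (hY : Y ≠ [])
    (h : ∀ y ∈ Y, m < y) : IsLyndon (List.replicate a m ++ Y) := by
  refine ⟨by simp [hY], ?_⟩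
  intro s hs hs0 hsne
  rcases suffix_aux m s Y a hs with h1 | ⟨c, hc, rfl⟩
  · obtain ⟨z, Z, rfl⟩ := List.exists_cons_of_ne_nil hs0
    have := lex_aux (h z (h1.subset (by simp))) Y Z 0 a (by omega)
    simpa using this
  · obtain ⟨z, Z, rfl⟩ := List.exists_cons_of_ne_nil hY
    refine lex_aux (h z (by simp)) _ Z c a ?_
    rcases Nat.lt_or_ge c a with h' | h'
    · exact h'
    · exact absurd (by rw [le_antisymm hc h']) hsne

def wdOdd (a b : ℕ) : List ℕ := List.replicate a 1 ++ 3 :: (List.replicate b 1 ++ [3])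

theorem lyndon_wd (a b : ℕ) (h : b < a) : IsLyndon (wdOdd a b) := by
  refine ⟨by simp [wdOdd], ?_⟩
  intro s hs hs0 hsne
  unfold wdOdd at *
  rcases suffix_aux 1 s _ a hs with h1 | ⟨c, hc, rfl⟩
  · rw [List.suffix_cons_iff] at h1
    rcases h1 with rfl | h1
    · exact lex_aux (by norm_num) _ _ 0 a (by omega)
    · rcases suffix_aux 1 s _ b h1 with h2 | ⟨c, hc, rfl⟩
      · rw [List.suffix_cons_iff] at h2
        rcases h2 with rfl | h2
        · exact lex_aux (by norm_num) _ _ 0 a (by omega)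
        · exact absurd (List.suffix_nil.mp h2) hs0
      · exact lex_aux (by norm_num) _ _ c a (by omega)
  · refine lex_aux (by norm_num) _ _ c a ?_
    rcases Nat.lt_or_ge c a with h' | h'
    · exact h'
    · exact absurd (by rw [le_antisymm hc h']) hsne

theorem wd_inj (a b a' b' : ℕ) (h : wdOdd a b = wdOdd a' b') : a = a' := by
  have h1 : ∀ a b, (wdOdd a b).idxOf 3 = a := by
    intro a b
    unfold wdOdd
    rw [List.idxOf_append_of_notMem (by simp [List.mem_replicate])]
    simp
  rw [← h1 a b, h, h1]

theorem wd_not_sorted (a b : ℕ) (hb : 1 ≤ b) : ¬ (wdOdd a b).Pairwise (· ≤ ·) := by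
  intro h
  unfold wdOdd at h
  rw [List.pairwise_append, List.pairwise_cons] at h
  have := h.2.1.1 1 (by simp [List.mem_replicate]; omega)
  omega

theorem sorted_decomp (m : ℕ) : ∀ T : List ℕ, (m :: T).Pairwise (· ≤ ·) →
    ∃ a Y, m :: T = List.replicate (a + 1) m ++ Y ∧ ∀ y ∈ Y, m < y := by
  intro T
  induction T with
  | nil => intro _; exact ⟨0, [], by simp, by simp⟩
  | cons t T ih =>
    intro h
    have h' := h
    rw [List.pairwise_cons, List.pairwise_cons] at h
    obtain ⟨h1, h2, h3⟩ := h
    have hmt := h1 t (by simp)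
    rcases hmt.eq_or_lt with rfl | hlt
    · obtain ⟨a, Y, e, hY⟩ := ih (List.pairwise_cons.2 ⟨h2, h3⟩)
      exact ⟨a + 1, Y, by rw [e]; simp [List.replicate_succ], hY⟩
    · refine ⟨0, t :: T, by simp, ?_⟩
      intro y hy
      rcases List.mem_cons.1 hy with rfl | hy
      · exact hlt
      · exact lt_of_lt_of_le hlt (h2 y hy)

def rectOdd {n : ℕ} (p : n.Partition) (d : ℕ) : Prop :=
  ∃ k, p.parts = Multiset.replicate k d ∧ 3 ≤ d ∧ 3 ≤ k

open Classical in
noncomputable def fOdd {n : ℕ} (p : n.Partition) : List ℕ :=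
  if h : ∃ d, rectOdd p d then wdOdd (n - 4 - h.choose) (h.choose - 2)
  else p.parts.sort (· ≤ ·)

theorem rect_ineq {n : ℕ} {p : n.Partition} {d : ℕ} (h : rectOdd p d) : 3 ≤ d ∧ 3 * d ≤ n := by
  obtain ⟨k, h1, h2, h3⟩ := h
  have := p.parts_sum
  rw [h1] at this
  simp at this
  exact ⟨h2, by nlinarith⟩

theorem rect_inj {n : ℕ} {p q : n.Partition} {d : ℕ} (hp : rectOdd p d) (hq : rectOdd q d) :
    p = q := by
  obtain ⟨k, h1, h2, h3⟩ := hp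
  obtain ⟨l, h4, h5, h6⟩ := hq
  have e1 := p.parts_sum
  have e2 := q.parts_sum
  rw [h1] at e1
  rw [h4] at e2
  simp only [Multiset.sum_replicate, smul_eq_mul] at e1 e2
  have : k = l := Nat.eq_of_mul_eq_mul_right (by omega : 0 < d) (e1.trans e2.symm)
  apply Nat.Partition.ext
  rw [h1, h4, this]

theorem fOdd_inj {n : ℕ} : Function.Injective (fOdd : n.Partition → List ℕ) := by
  intro p q h
  unfold fOdd at h
  split_ifs at h with hp hq hq
  · have i1 := rect_ineq hp.choose_spec
    have i2 := rect_ineq hq.choose_spec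
    have := wd_inj _ _ _ _ h
    have e : hp.choose = hq.choose := by omega
    have s := hp.choose_spec
    rw [e] at s
    exact rect_inj s hq.choose_spec
  · have i1 := rect_ineq hp.choose_spec
    exact absurd (h ▸ Multiset.pairwise_sort _ _) (wd_not_sorted _ (hp.choose - 2) (by omega))
  · have i1 := rect_ineq hq.choose_spec
    exact absurd (h ▸ Multiset.pairwise_sort _ _) (wd_not_sorted _ (hq.choose - 2) (by omega))
  · apply Nat.Partition.ext
    rw [← Multiset.sort_eq p.parts (· ≤ ·), h, Multiset.sort_eq]

theorem fOdd_mem {n : ℕ} (hn : 1 ≤ n) (p : n.Partition) (hp : p ∈ Nat.Partition.odds n)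
    (h1 : p.parts ≠ Multiset.replicate n 1) (h2 : p.parts ≠ Multiset.replicate 2 (n / 2)) :
    (∀ a ∈ fOdd p, Odd a) ∧ (fOdd p).sum = n ∧ IsLyndon (fOdd p) := by
  have hodd : ∀ a ∈ p.parts, Odd a := by
    intro a ha
    simp [Nat.Partition.odds, Nat.Partition.restricted] at hp
    exact hp a ha
  unfold fOdd
  split_ifs with h
  · have i := rect_ineq h.choose_spec
    generalize h.choose = d at *
    refine ⟨?_, ?_, lyndon_wd _ _ (by omega)⟩
    · intro a ha
      simp [wdOdd, List.mem_replicate] at ha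
      have : a = 1 ∨ a = 3 := by tauto
      rcases this with rfl | rfl <;> decide
    · simp [wdOdd]; omega
  · have hsum : (p.parts.sort (· ≤ ·)).sum = n := by
      rw [← Multiset.sum_coe, Multiset.sort_eq, p.parts_sum]
    refine ⟨by simpa using hodd, hsum, ?_⟩
    have hpw := Multiset.pairwise_sort p.parts (· ≤ ·)
    have he := Multiset.sort_eq p.parts (· ≤ ·)
    generalize p.parts.sort (· ≤ ·) = L at *
    cases L with
    | nil => simp at hsum; omega
    | cons m T =>
      obtain ⟨a, Y, e, hY⟩ := sorted_decomp m T hpw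
      rw [e] at he hsum ⊢
      by_cases hY0 : Y = []
      · subst hY0
        simp only [List.append_nil, Multiset.coe_replicate, List.sum_replicate,
          smul_eq_mul] at he hsum ⊢
        have hm : Odd m := hodd m (by rw [← he]; simp)
        rcases a with _ | _ | a
        · refine ⟨by simp, ?_⟩
          intro s hs hs0 hsne
          rw [zero_add, List.replicate_one, List.suffix_cons_iff] at hs
          rcases hs with hs | hs
          · exact absurd hs hsne
          · exact absurd (List.suffix_nil.mp hs) hs0
        · exact absurd (by rw [← he, ← hsum]; simp) h2
        · exfalso
          by_cases hm1 : m = 1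
          · subst hm1
            apply h1
            rw [← he, ← hsum, mul_one]
          · apply h
            refine ⟨m, _, he.symm, ?_, by omega⟩
            obtain ⟨r, hr⟩ := hm
            omega
      · exact lyndon_sorted m (a + 1) Y (by omega) hY0 hY

theorem finite_odd_words (n : ℕ) :
    Finite {w : List ℕ // (∀ a ∈ w, Odd a) ∧ w.sum = n ∧ IsLyndon w} := by
  let g : {w : List ℕ // (∀ a ∈ w, Odd a) ∧ w.sum = n ∧ IsLyndon w} → Composition n :=
    fun w => ⟨w.1, fun {i} hi => (w.2.1 i hi).pos, w.2.2.1⟩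
  refine Finite.of_injective g ?_
  intro w v h
  exact Subtype.ext (congrArg Composition.blocks h)

/-- For every `n ≥ 1`, the number of Lyndon words over the odd positive integers of
weight `n` is at least `N_n − 2`, where `N_n` is the number of partitions of `n` into
odd parts. -/
theorem statement13 (n : ℕ) (hn : 1 ≤ n) :
    ((Nat.Partition.odds n).card : ℤ) - 2 ≤ (klyOdd n : ℤ) := by
  classical
  have := finite_odd_words n
  let B : Finset n.Partition := Finset.univ.filter
    (fun p => p.parts ∈ ({Multiset.replicate n 1, Multiset.replicate 2 (n / 2)} : Finset _))
  have hB : B.card ≤ 2 := by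
    refine le_trans (Finset.card_le_card_of_injOn (fun p => p.parts) ?_ ?_)
      (Finset.card_le_two (a := Multiset.replicate n 1) (b := Multiset.replicate 2 (n / 2)))
    · intro p hp
      simpa [B] using hp
    · intro p _ q _ h
      exact Nat.Partition.ext h
  have hS : ((Nat.Partition.odds n) \ B).card ≤ klyOdd n := by
    unfold klyOdd
    rw [← Nat.card_eq_finsetCard]
    have key : ∀ p : ↥((Nat.Partition.odds n) \ B),
        (∀ a ∈ fOdd p.1, Odd a) ∧ (fOdd p.1).sum = n ∧ IsLyndon (fOdd p.1) := by
      rintro ⟨p, hp⟩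
      simp only [Finset.mem_sdiff, B, Finset.mem_filter, Finset.mem_univ, true_and,
        Finset.mem_insert, Finset.mem_singleton, not_or] at hp
      exact fOdd_mem hn p hp.1 hp.2.1 hp.2.2
    refine Nat.card_le_card_of_injective (fun p => ⟨fOdd p.1, key p⟩) ?_
    intro p q h
    exact Subtype.ext (fOdd_inj (congrArg Subtype.val h))
  have := Finset.le_card_sdiff B (Nat.Partition.odds n)
  omega
end

section
/- Let r ≥ 2, let k ≥ 1, and let j_1, …, j_k be odd positive integers. In ℤ[t_1, …, t_r] set g = ∑_{σ ∈ S_k} sgn(σ) · M_{(j_{σ(1)}, …, j_{σ(k)})}(t_1, …, t_r), the signed sum of quasi-symmetric monomials over all permutations σ of {1, …, k}. Then g satisfies the q-th cancellation relation for every q with 1 ≤ q ≤ r−1. -/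
open scoped Classical
open MvPolynomial

/-- The quasi-symmetric monomial `M_{(a_1,…,a_k)}` in `r` variables:
`∑_{1 ≤ l_1 < ⋯ < l_k ≤ r} t_{l_1}^{a_1} ⋯ t_{l_k}^{a_k}`. -/
noncomputable def qsymMonomialFn (r k : ℕ) (a : Fin k → ℕ) : MvPolynomial (Fin r) ℤ :=
  ∑ l ∈ Finset.univ.filter (fun l : Fin k → Fin r => StrictMono l),
    ∏ i : Fin k, X (l i) ^ a i

/-- `g` satisfies the `q`-th cancellation relation (here `q` is `0`-indexed,
`0 ≤ q ≤ r-2`): substituting `s` for `t_q` and `-s` for `t_{q+1}` gives the same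
polynomial as substituting `0` for both. -/
def CancelRel {r : ℕ} (g : MvPolynomial (Fin r) ℤ) (q : ℕ) (hq : q + 1 < r) : Prop :=
  aeval (fun j : Fin r =>
      if (j : ℕ) = q then X (⟨q, by omega⟩ : Fin r)
      else if (j : ℕ) = q + 1 then -X (⟨q, by omega⟩ : Fin r)
      else X j) g =
  aeval (fun j : Fin r =>
      if (j : ℕ) = q then (0 : MvPolynomial (Fin r) ℤ)
      else if (j : ℕ) = q + 1 then 0
      else X j) g

section Aux

variable {r k : ℕ} {R : Type*} [CommRing R]

/-- The determinant attached to an index choice `l`. -/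
noncomputable def rowDet (j : Fin k → ℕ) (x : Fin r → R) (l : Fin k → Fin r) : R :=
  Matrix.det (Matrix.of fun i i' : Fin k => x (l i) ^ j i')

theorem aeval_signed (j : Fin k → ℕ) (x : Fin r → MvPolynomial (Fin r) ℤ) :
    aeval x (∑ σ : Equiv.Perm (Fin k),
          ((Equiv.Perm.sign σ : ℤ) • qsymMonomialFn r k (j ∘ σ))) =
    ∑ l ∈ Finset.univ.filter (fun l : Fin k → Fin r => StrictMono l), rowDet j x l := by
  simp only [map_sum, map_zsmul, qsymMonomialFn, map_prod, map_pow, aeval_X, Finset.smul_sum]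
  rw [Finset.sum_comm]
  refine Finset.sum_congr rfl fun l _ => ?_
  rw [rowDet, ← Matrix.det_transpose, Matrix.det_apply]
  refine Finset.sum_congr rfl fun σ _ => ?_
  simp [Units.smul_def]

theorem rowDet_zero (j : Fin k → ℕ) (hodd : ∀ i, Odd (j i)) (x : Fin r → R)
    (l : Fin k → Fin r) (i : Fin k) (h : x (l i) = 0) : rowDet j x l = 0 := by
  refine Matrix.det_eq_zero_of_row_eq_zero i fun i' => ?_
  simp [h, (hodd i').pos.ne']

theorem rowDet_neg (j : Fin k → ℕ) (hodd : ∀ i, Odd (j i)) (x : Fin r → R)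
    (l l' : Fin k → Fin r) (i : Fin k) (h : x (l' i) = - x (l i))
    (h' : ∀ i', i' ≠ i → l' i' = l i') : rowDet j x l + rowDet j x l' = 0 := by
  have : (Matrix.of fun a b : Fin k => x (l' a) ^ j b) =
      (Matrix.of fun a b : Fin k => x (l a) ^ j b).updateRow i
        ((-1 : R) • (Matrix.of fun a b : Fin k => x (l a) ^ j b) i) := by
    ext a b
    by_cases ha : a = i
    · subst ha
      simp [h, (hodd b).neg_pow]
    · simp [Matrix.updateRow_ne ha, h' a ha]
  rw [rowDet, rowDet, this, Matrix.det_updateRow_smul, Matrix.updateRow_eq_self]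
  ring

theorem rowDet_both (j : Fin k → ℕ) (hodd : ∀ i, Odd (j i)) (x : Fin r → R)
    (l : Fin k → Fin r) (i i' : Fin k) (hne : i ≠ i') (h : x (l i') = - x (l i)) :
    rowDet j x l = 0 := by
  have h1 := rowDet_neg j hodd x l (Function.update l i' (l i)) i' (by simp [h])
    (fun a ha => by simp [ha])
  have h2 : rowDet j x (Function.update l i' (l i)) = 0 := by
    refine Matrix.det_zero_of_row_eq hne ?_
    ext b
    simp [hne]
  rwa [h2, add_zero] at h1

theorem sum_rowDet (j : Fin k → ℕ) (hodd : ∀ i, Odd (j i)) (x y : Fin r → R) (a b : Fin r)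
    (hab : (b : ℕ) = a + 1) (hx : x b = - x a) (hya : y a = 0) (hyb : y b = 0)
    (hxy : ∀ c, c ≠ a → c ≠ b → x c = y c) :
    ∑ l ∈ Finset.univ.filter (fun l : Fin k → Fin r => StrictMono l), rowDet j x l =
    ∑ l ∈ Finset.univ.filter (fun l : Fin k → Fin r => StrictMono l), rowDet j y l := by
  have hne : a ≠ b := by
    rintro rfl
    omega
  rw [← sub_eq_zero, ← Finset.sum_sub_distrib]
  have hyx : ∀ z : Fin r → R, z b = - z a → ∀ l : Fin k → Fin r, StrictMono l →
      ¬ StrictMono (Equiv.swap a b ∘ l) → rowDet j z l = 0 := by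
    intro z hz l hl hn
    have : ∃ i i', l i = a ∧ l i' = b := by
      by_contra! hcon
      apply hn
      intro i i' hii
      have h1 := hl hii
      have h2 := hcon i i'
      simp only [Function.comp, Equiv.swap_apply_def]
      simp only [Fin.ext_iff, Fin.lt_def, ne_eq] at *
      split_ifs <;> simp_all <;> omega
    obtain ⟨i, i', h1, h2⟩ := this
    refine rowDet_both j hodd z l i i' ?_ (by rw [h1, h2, hz])
    rintro rfl
    exact hne (h1.symm.trans h2)
  have hyneg : y b = - y a := by simp [hya, hyb]
  have key : ∀ z : Fin r → R, z b = - z a → ∀ l : Fin k → Fin r, StrictMono l →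
      StrictMono (Equiv.swap a b ∘ l) → (∃ i, l i = a ∨ l i = b) →
      rowDet j z l + rowDet j z (Equiv.swap a b ∘ l) = 0 := by
    rintro z hz l hl hs ⟨i, hi⟩
    refine rowDet_neg j hodd z l _ i ?_ ?_
    · rcases hi with hi | hi <;> simp [hi, hz]
    · intro i' hi'
      have e1 : l i' ≠ l i := fun h => hi' (hl.injective h)
      apply Equiv.swap_apply_of_ne_of_ne
      · intro h
        rcases hi with hi | hi
        · exact e1 (h.trans hi.symm)
        · rcases lt_or_gt_of_ne hi' with hh | hh
          · have := hs hh
            simp only [Function.comp, h, hi, Equiv.swap_apply_left, Equiv.swap_apply_right, Fin.lt_def] at this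
            omega
          · have := hl hh
            simp only [Function.comp, h, hi, Equiv.swap_apply_left, Equiv.swap_apply_right, Fin.lt_def] at this
            omega
      · intro h
        rcases hi with hi | hi
        · rcases lt_or_gt_of_ne hi' with hh | hh
          · have := hl hh
            simp only [Function.comp, h, hi, Equiv.swap_apply_left, Equiv.swap_apply_right, Fin.lt_def] at this
            omega
          · have := hs hh
            simp only [Function.comp, h, hi, Equiv.swap_apply_left, Equiv.swap_apply_right, Fin.lt_def] at this
            omega
        · exact e1 (h.trans hi.symm)
  have none : ∀ l : Fin k → Fin r, (¬ ∃ i, l i = a ∨ l i = b) →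
      rowDet j x l - rowDet j y l = 0 := by
    intro l h
    push Not at h
    rw [sub_eq_zero, rowDet, rowDet]
    congr 1
    ext i i'
    simp [hxy (l i) (h i).1 (h i).2]
  refine Finset.sum_involution
    (fun l _ => if StrictMono (Equiv.swap a b ∘ l) then Equiv.swap a b ∘ l else l) ?_ ?_ ?_ ?_
  · intro l hl
    have hl := (Finset.mem_filter.1 hl).2
    split_ifs with hs
    · by_cases he : ∃ i, l i = a ∨ l i = b
      · linear_combination key x hx l hl hs he - key y hyneg l hl hs he
      · have : Equiv.swap a b ∘ l = l := by
          push Not at he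
          funext i
          exact Equiv.swap_apply_of_ne_of_ne (he i).1 (he i).2
        rw [this, none l he, add_zero]
    · rw [hyx x hx l hl hs, hyx y hyneg l hl hs]
      simp
  · intro l hl hne0
    have hl := (Finset.mem_filter.1 hl).2
    split_ifs with hs
    · intro heq
      apply hne0
      apply none
      rintro ⟨i, hi⟩
      have := congrFun heq i
      rcases hi with hi | hi
      · simp [hi] at this
        exact hne this.symm
      · simp [hi] at this
        exact hne this
    · exact absurd (by rw [hyx x hx l hl hs, hyx y hyneg l hl hs, sub_zero]) hne0
  · intro l hl
    split_ifs with hs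
    · simpa using hs
    · exact hl
  · intro l hl
    have hl := (Finset.mem_filter.1 hl).2
    have e : Equiv.swap a b ∘ (Equiv.swap a b ∘ l) = l := by
      funext i
      simp
    by_cases hs : StrictMono (Equiv.swap a b ∘ l)
    · rw [if_pos hs, e, if_pos hl]
    · rw [if_neg hs, if_neg hs]

end Aux

/-- For `r ≥ 2`, `k ≥ 1` and odd positive integers `j_1, …, j_k`, the signed sum
`g = ∑_{σ ∈ S_k} sgn(σ) M_{(j_{σ(1)}, …, j_{σ(k)})}` of quasi-symmetric monomials over all
permutations of `{1,…,k}` satisfies every cancellation relation. -/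
theorem statement18 (r k : ℕ) (hr : 2 ≤ r) (hk : 1 ≤ k) (j : Fin k → ℕ)
    (hodd : ∀ i, Odd (j i)) :
    ∀ (q : ℕ) (hq : q + 1 < r),
      CancelRel
        (∑ σ : Equiv.Perm (Fin k),
          ((Equiv.Perm.sign σ : ℤ) • qsymMonomialFn r k (j ∘ σ)))
        q hq := by
  intro q hq
  unfold CancelRel
  rw [aeval_signed, aeval_signed]
  refine sum_rowDet j hodd _ _ ⟨q, by omega⟩ ⟨q + 1, hq⟩ rfl ?_ ?_ ?_ ?_
  · simp
  · simp
  · simp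
  · intro c h1 h2
    have h1' : (c : ℕ) ≠ q := fun h => h1 (Fin.ext h)
    have h2' : (c : ℕ) ≠ q + 1 := fun h => h2 (Fin.ext h)
    simp [h1', h2']
end

section
/- Let ω = (a_1, …, a_k) be a composition with k ≥ 1, and let r ≥ k + 2. The quasi-symmetric monomial M_ω(t_1, …, t_r) ∈ ℤ[t_1, …, t_r] satisfies the q-th cancellation relation for every q with 1 ≤ q ≤ r−1 if and only if k = 1 and a_1 is odd. -/
open scoped Classical
open MvPolynomial

theorem qs_aeval {r k : ℕ} {A : Type*} [CommRing A] [Algebra ℤ A] (a : Fin k → ℕ) (f : Fin r → A) :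
    aeval f (qsymMonomialFn r k a) =
      ∑ l ∈ Finset.univ.filter (fun l : Fin k → Fin r => StrictMono l),
        ∏ i : Fin k, f (l i) ^ a i := by
  simp [qsymMonomialFn]

theorem qs_one {r : ℕ} {A : Type*} [CommRing A] [Algebra ℤ A] (a : Fin 1 → ℕ) (f : Fin r → A) :
    aeval f (qsymMonomialFn r 1 a) = ∑ j, f j ^ a 0 := by
  rw [qs_aeval, Finset.filter_true_of_mem (fun l _ => Subsingleton.strictMono l)]
  rw [← (Equiv.funUnique (Fin 1) (Fin r)).sum_comp]
  simp

theorem qs_id {r k : ℕ} (l : Fin k → Fin r) (hl : StrictMono l)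
    (h : ∀ i, (l i : ℕ) < k) (i : Fin k) : (l i : ℕ) = i := by
  have hg : StrictMono (fun i => (⟨l i, h i⟩ : Fin k)) := fun x y hxy => hl hxy
  have h1 := hg.le_apply (x := i)
  have h2 := hg.apply_le (x := i)
  exact le_antisymm h2 h1

/-- Evaluation when the support is among the first `k` variables. -/
theorem qs_eval {r k : ℕ} (hkr : k ≤ r) (a : Fin k → ℕ) (ha : ∀ i, 0 < a i) (f : Fin r → ℤ)
    (hf : ∀ j : Fin r, k ≤ (j : ℕ) → f j = 0) :
    aeval f (qsymMonomialFn r k a) = ∏ i : Fin k, f (Fin.castLE hkr i) ^ a i := by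
  rw [qs_aeval]
  apply Finset.sum_eq_single_of_mem (Fin.castLE hkr)
  · simpa using Fin.strictMono_castLE hkr
  · intro l hl hne
    have hl' : StrictMono l := by simpa using hl
    by_cases h : ∀ i, (l i : ℕ) < k
    · exact absurd (funext fun i => Fin.ext (qs_id l hl' h i)) hne
    · push Not at h
      obtain ⟨i, hi⟩ := h
      apply Finset.prod_eq_zero (Finset.mem_univ i)
      have hne0 := (ha i).ne'
      rw [hf _ hi, zero_pow hne0]

/-- Let `ω = (a_1, …, a_k)` be a composition with `k ≥ 1` and let `r ≥ k + 2`.  The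
quasi-symmetric monomial `M_ω ∈ ℤ[t_1,…,t_r]` satisfies every cancellation relation if
and only if `k = 1` and `a_1` is odd. -/
theorem statement19 (k : ℕ) (hk : 1 ≤ k) (a : Fin k → ℕ) (ha : ∀ i, 0 < a i)
    (r : ℕ) (hr : k + 2 ≤ r) :
    (∀ (q : ℕ) (hq : q + 1 < r), CancelRel (qsymMonomialFn r k a) q hq) ↔
      (k = 1 ∧ ∀ i, Odd (a i)) := by
  constructor
  · intro H
    have h0 := H 0 (by omega)
    unfold CancelRel at h0
    let y : Fin r → ℤ := fun j => if (j : ℕ) < k then 1 else 0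
    have h1 := congrArg (aeval y) h0
    rw [← AlgHom.comp_apply, ← AlgHom.comp_apply, comp_aeval, comp_aeval] at h1
    by_cases hk1 : k = 1
    · subst hk1
      refine ⟨rfl, fun i => ?_⟩
      rw [Subsingleton.elim i 0]
      rw [qs_one, qs_one] at h1
      by_contra hodd
      have heven : Even (a 0) := Nat.not_odd_iff_even.mp hodd
      have hlt := Finset.sum_lt_sum (s := Finset.univ)
        (f := fun j : Fin r => (aeval y (if (j : ℕ) = 0 then (0 : MvPolynomial (Fin r) ℤ)
          else if (j : ℕ) = 0 + 1 then 0 else X j)) ^ a 0)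
        (g := fun j : Fin r => (aeval y (if (j : ℕ) = 0 then X (⟨0, by omega⟩ : Fin r)
          else if (j : ℕ) = 0 + 1 then -X (⟨0, by omega⟩ : Fin r) else X j)) ^ a 0)
        (fun j _ => by
          have := (ha 0).ne'
          split_ifs
          · simp [y, this]
          · rw [map_zero, zero_pow this]
            exact heven.pow_nonneg _
          · exact le_rfl)
        ⟨⟨0, by omega⟩, Finset.mem_univ _, by simp [y, (ha 0).ne']⟩
      exact absurd h1 hlt.ne'
    · exfalso
      have hk2 : 2 ≤ k := by omega
      rw [qs_eval (by omega) a ha, qs_eval (by omega) a ha] at h1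
      · have h1 := h1.trans (Finset.prod_eq_zero (Finset.mem_univ (⟨0, by omega⟩ : Fin k))
          (by simp [(ha _).ne']))
        rw [Finset.prod_eq_zero_iff] at h1
        obtain ⟨i, -, hi⟩ := h1
        have hi := eq_zero_of_pow_eq_zero hi
        have hik := i.2
        have hk0 : 0 < k := by omega
        simp only [Fin.val_castLE] at hi
        split_ifs at hi
        · simp [y, hk0] at hi
        · rw [map_neg] at hi
          simp [y, hk0] at hi
        · simp [y] at hi
      · intro j hj
        rw [if_neg (by omega), if_neg (by omega)]
        simp [y, hj]
      · intro j hj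
        rw [if_neg (by omega), if_neg (by omega)]
        simp [y, hj]
  · rintro ⟨rfl, hodd⟩ q hq
    unfold CancelRel
    rw [qs_one, qs_one, ← sub_eq_zero, ← Finset.sum_sub_distrib]
    rw [Finset.sum_eq_add_of_mem (⟨q, by omega⟩ : Fin r) ⟨q + 1, hq⟩
      (Finset.mem_univ _) (Finset.mem_univ _) (by simp)]
    · simp [(ha 0).ne', (hodd 0).neg_pow]
    · intro c _ hc
      have h1 : (c : ℕ) ≠ q := fun h => hc.1 (Fin.ext h)
      have h2 : (c : ℕ) ≠ q + 1 := fun h => hc.2 (Fin.ext h)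
      simp [h1, h2]
end
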